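/- There exists an absolute constant C7 > 0 such that the following holds. Fix integers p ≥ 1, n ≥ 2, m ≥ n with m ≤ np, a sparsity level s with 2 ≤ s ≤ np, and a number 0 < δ ≤ 1. Let Φ be the random m × (np) multichannel probe matrix built from i.i.d. N(0, 1/m) probe samples. If m ≥ C7 · δ⁻² · s · (log(np))⁵, then E‖I − Φ*Φ‖_s ≤ δ. -/

import Mathlib

open MeasureTheory ProbabilityTheory Matrix

/-- The `s`-norm of a square complex matrix: the supremum of `|y* A x|` over index
sets `Γ` of cardinality at most `s` and unit-`ℓ₂`-norm vectors `x, y` supported on `Γ`. -/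
noncomputable def snormS {ι : Type*} [Fintype ι] (s : ℕ) (A : Matrix ι ι ℂ) : ℝ :=
  sSup {r : ℝ | ∃ (Γ : Finset ι) (x y : ι → ℂ),
    Γ.card ≤ s ∧ (∀ i, i ∉ Γ → x i = 0) ∧ (∀ i, i ∉ Γ → y i = 0) ∧
    (∑ i, ‖x i‖ ^ 2) = 1 ∧ (∑ i, ‖y i‖ ^ 2) = 1 ∧
    r = ‖dotProduct (star y) (A.mulVec x)‖}

/-- Law of `p·m` i.i.d. real Gaussian probe samples of mean `0` and variance `1/m`. -/
noncomputable def gaussMeasure (p m : ℕ) : Measure (Fin p → Fin m → ℝ) :=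
  Measure.pi fun _ => Measure.pi fun _ => gaussianReal 0 ((m : NNReal))⁻¹

/-- The `m × (np)` multichannel probe matrix: the `i`-th block is the first `n`
columns of the `m × m` circulant matrix with first row
`(φ_i(n), φ_i(n−1), …, φ_i(1), φ_i(m), …, φ_i(n+1))`. -/
def probeMatrix (p n m : ℕ) (φ : Fin p → Fin m → ℝ) :
    Matrix (Fin m) (Fin p × Fin n) ℝ :=
  Matrix.of fun j ik => φ ik.1 ⟨(n - 1 - (ik.2 : ℕ) + (j : ℕ)) % m, Nat.mod_lt _ j.pos⟩


noncomputable def sg (b : Bool) : ℝ := if b then 1 else -1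

lemma rad_mgf {J : Type*} [Fintype J] [DecidableEq J] (v : J → ℝ) :
    ∑ ε : J → Bool, Real.exp (∑ j, sg (ε j) * v j) ≤
      2 ^ Fintype.card J * Real.exp ((∑ j, v j ^ 2) / 2) := by
  have h1 : ∑ ε : J → Bool, Real.exp (∑ j, sg (ε j) * v j)
      = ∏ j : J, ∑ b : Bool, Real.exp (sg b * v j) := by
    rw [Finset.prod_univ_sum, Fintype.piFinset_univ]
    refine Finset.sum_congr rfl fun ε _ => ?_
    rw [Real.exp_sum]
  rw [h1]
  have h2 : ∀ j, ∑ b : Bool, Real.exp (sg b * v j) ≤ 2 * Real.exp (v j ^ 2 / 2) := by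
    intro j
    have := Real.cosh_le_exp_half_sq (v j)
    rw [Real.cosh_eq] at this
    simp [sg]
    linarith
  calc _ ≤ ∏ j : J, (2 * Real.exp (v j ^ 2 / 2)) :=
        Finset.prod_le_prod (fun j _ => Finset.sum_nonneg fun b _ => (Real.exp_pos _).le)
          (fun j _ => h2 j)
    _ = _ := by
        rw [Finset.prod_mul_distrib, ← Real.exp_sum, Finset.sum_div]
        simp

lemma le_of_exp_le {y S c : ℝ} (hc : 0 < c) (h : Real.exp y ≤ S) :
    y ≤ S / c - 1 + Real.log c := by
  have hS : 0 < S := lt_of_lt_of_le (Real.exp_pos _) h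
  have h1 : y ≤ Real.log S := by rwa [Real.le_log_iff_exp_le hS]
  have h2 := Real.log_le_sub_one_of_pos (div_pos hS hc)
  rw [Real.log_div hS.ne' hc.ne'] at h2
  linarith

lemma max_ineq_aux {I J : Type*} [Fintype I] [Fintype J] [DecidableEq J] [Nonempty I]
    (V : I → J → ℝ) (σ A : ℝ) (hσ : 0 < σ) (hA : 0 < A)
    (hI : Real.log (2 * Fintype.card I) ≤ A)
    (hV : ∀ i, ∑ j, V i j ^ 2 ≤ σ ^ 2) (sel : (J → Bool) → I) :
    ∑ ε : J → Bool, |∑ j, sg (ε j) * V (sel ε) j| ≤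
      2 ^ Fintype.card J * (σ * Real.sqrt (2 * A)) := by
  set l : ℝ := Real.sqrt (2 * A) / σ with hl
  have hsq : 0 < Real.sqrt (2 * A) := Real.sqrt_pos.2 (by linarith)
  have hlpos : 0 < l := div_pos hsq hσ
  set cI : ℝ := (Fintype.card I : ℝ) with hcI
  have hcIpos : 0 < cI := by
    rw [hcI]; exact_mod_cast Fintype.card_pos
  set c : ℝ := 2 * cI * Real.exp (l ^ 2 * σ ^ 2 / 2) with hc
  have hcpos : 0 < c := by positivity
  set S : (J → Bool) → ℝ := fun ε => ∑ i, (Real.exp (∑ j, sg (ε j) * (l * V i j)) +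
      Real.exp (∑ j, sg (ε j) * (-l * V i j))) with hS
  have key : ∀ ε : J → Bool, l * |∑ j, sg (ε j) * V (sel ε) j| ≤ S ε / c - 1 + Real.log c := by
    intro ε
    apply le_of_exp_le hcpos
    have h1 : Real.exp (l * |∑ j, sg (ε j) * V (sel ε) j|) ≤
       (Real.exp (∑ j, sg (ε j) * (l * V (sel ε) j)) +
      Real.exp (∑ j, sg (ε j) * (-l * V (sel ε) j))) := by
      have e1 : ∑ j, sg (ε j) * (l * V (sel ε) j) = l * ∑ j, sg (ε j) * V (sel ε) j := by
        rw [Finset.mul_sum]; exact Finset.sum_congr rfl fun j _ => by ring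
      have e2 : ∑ j, sg (ε j) * (-l * V (sel ε) j) = -(l * ∑ j, sg (ε j) * V (sel ε) j) := by
        rw [Finset.mul_sum, ← Finset.sum_neg_distrib]
        exact Finset.sum_congr rfl fun j _ => by ring
      rw [e1, e2]
      rcases abs_cases (∑ j, sg (ε j) * V (sel ε) j) with ⟨h, _⟩ | ⟨h, _⟩
      · rw [h]; linarith [Real.exp_pos (-(l * ∑ j, sg (ε j) * V (sel ε) j))]
      · rw [h, mul_neg]; linarith [Real.exp_pos (l * ∑ j, sg (ε j) * V (sel ε) j)]
    refine h1.trans ?_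
    exact Finset.single_le_sum (f := fun i => (Real.exp (∑ j, sg (ε j) * (l * V i j)) +
      Real.exp (∑ j, sg (ε j) * (-l * V i j)))) (fun i _ => by positivity) (Finset.mem_univ _)
  have hSsum : ∑ ε, S ε ≤ 2 ^ Fintype.card J * c := by
    rw [hS, Finset.sum_comm]
    have : ∀ i, ∑ ε : J → Bool, (Real.exp (∑ j, sg (ε j) * (l * V i j)) +
      Real.exp (∑ j, sg (ε j) * (-l * V i j))) ≤
        2 ^ Fintype.card J * (2 * Real.exp (l ^ 2 * σ ^ 2 / 2)) := by
      intro i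
      rw [Finset.sum_add_distrib]
      have a1 := rad_mgf (fun j => l * V i j)
      have a2 := rad_mgf (fun j => -l * V i j)
      have b : ∑ j, (l * V i j) ^ 2 ≤ l ^ 2 * σ ^ 2 := by
        simp_rw [mul_pow]; rw [← Finset.mul_sum]
        exact mul_le_mul_of_nonneg_left (hV i) (by positivity)
      have b' : ∑ j, (-l * V i j) ^ 2 ≤ l ^ 2 * σ ^ 2 := by
        simpa [mul_pow] using b
      have c1 : Real.exp ((∑ j, (l * V i j) ^ 2) / 2) ≤ Real.exp (l ^ 2 * σ ^ 2 / 2) :=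
        Real.exp_le_exp.2 (by linarith)
      have c2 : Real.exp ((∑ j, (-l * V i j) ^ 2) / 2) ≤ Real.exp (l ^ 2 * σ ^ 2 / 2) :=
        Real.exp_le_exp.2 (by linarith)
      have d : (0:ℝ) ≤ 2 ^ Fintype.card J := by positivity
      have := mul_le_mul_of_nonneg_left c1 d
      have := mul_le_mul_of_nonneg_left c2 d
      linarith
    refine (Finset.sum_le_sum fun i _ => this i).trans ?_
    simp only [Finset.sum_const, Finset.card_univ, nsmul_eq_mul, hc]
    apply le_of_eq; ring
  have hfin : l * ∑ ε : J → Bool, |∑ j, sg (ε j) * V (sel ε) j| ≤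
      2 ^ Fintype.card J * Real.log c := by
    rw [Finset.mul_sum]
    refine (Finset.sum_le_sum fun ε _ => key ε).trans ?_
    rw [Finset.sum_add_distrib, Finset.sum_sub_distrib, ← Finset.sum_div]
    have : (∑ ε, S ε) / c ≤ 2 ^ Fintype.card J := by
      rw [div_le_iff₀ hcpos]; exact hSsum
    simp only [Finset.sum_const, Finset.card_univ, nsmul_eq_mul, Fintype.card_fun,
      Fintype.card_bool]
    push_cast
    linarith
  have hlog : Real.log c ≤ l * (σ * Real.sqrt (2 * A)) := by
    rw [hc, Real.log_mul (by positivity) (by positivity), Real.log_exp]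
    have e1 : l * σ = Real.sqrt (2 * A) := by rw [hl]; field_simp
    have e2 : l ^ 2 * σ ^ 2 = 2 * A := by
      rw [← mul_pow, e1, Real.sq_sqrt (by linarith)]
    have e3 : l * (σ * Real.sqrt (2 * A)) = 2 * A := by
      rw [← mul_assoc, e1, Real.mul_self_sqrt (by linarith)]
    rw [e2, e3]; linarith
  have d : (0:ℝ) ≤ 2 ^ Fintype.card J := by positivity
  have := mul_le_mul_of_nonneg_left hlog d
  have h3 : l * ∑ ε : J → Bool, |∑ j, sg (ε j) * V (sel ε) j| ≤
      l * (2 ^ Fintype.card J * (σ * Real.sqrt (2 * A))) := by linarith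
  exact le_of_mul_le_mul_left h3 hlpos

lemma max_ineq {I J : Type*} [Fintype I] [Fintype J] [DecidableEq J] [Nonempty I]
    (V : I → J → ℝ) (σ A : ℝ) (hσ : 0 < σ) (hA : 0 < A)
    (hI : Real.log (2 * Fintype.card I) ≤ A) (sel : (J → Bool) → I)
    (hV : ∀ ε, ∑ j, V (sel ε) j ^ 2 ≤ σ ^ 2)  :
    ∑ ε : J → Bool, |∑ j, sg (ε j) * V (sel ε) j| ≤
      2 ^ Fintype.card J * (σ * Real.sqrt (2 * A)) := by
  classical
  have := max_ineq_aux (fun i => if i ∈ Set.range sel then V i else 0) σ A hσ hA hI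
    (by
      intro i
      by_cases h : i ∈ Set.range sel
      · obtain ⟨ε, rfl⟩ := h
        simpa using hV ε
      · simp only [h, if_false]; simp; positivity) sel
  simpa using this

/-- one step of the greedy Maurey argument -/
lemma cosh_step {O : Type*} [Fintype O] (p : O → ℝ) (hp : ∀ o, 0 ≤ p o) (hp1 : ∑ o, p o = 1)
    (D : O → ℝ) (B : ℝ) (hB : 0 < B) (hD : ∀ o, |D o| ≤ B) (h0 : ∑ o, p o * D o = 0) (S : ℝ) :
    ∑ o, p o * Real.cosh (S + D o) ≤ Real.cosh S * Real.cosh B := by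
  have e : ∀ o, Real.exp (D o) ≤ Real.cosh B + D o / B * Real.sinh B := by
    intro o
    have := Real.exp_mul_le_cosh_add_mul_sinh (t := D o / B)
      (by rw [abs_div, abs_of_pos hB]; exact (div_le_one hB).2 (hD o)) B
    rwa [div_mul_cancel₀ _ hB.ne'] at this
  have e' : ∀ o, Real.exp (-D o) ≤ Real.cosh B - D o / B * Real.sinh B := by
    intro o
    have := Real.exp_mul_le_cosh_add_mul_sinh (t := - D o / B)
      (by rw [abs_div, abs_of_pos hB, abs_neg]; exact (div_le_one hB).2 (hD o)) B
    rw [div_mul_cancel₀ _ hB.ne'] at this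
    linarith [this, (by ring : -D o / B * Real.sinh B = - (D o / B * Real.sinh B))]
  have h : ∀ o, p o * Real.cosh (S + D o) ≤
      p o * (Real.cosh S * Real.cosh B) + (p o * D o) * (Real.sinh S * Real.sinh B / B) := by
    intro o
    have : Real.cosh (S + D o) ≤ Real.cosh S * Real.cosh B +
        D o * (Real.sinh S * Real.sinh B / B) := by
      rw [Real.cosh_eq (S + D o), Real.exp_add, neg_add, Real.exp_add]
      have m1 := mul_le_mul_of_nonneg_left (e o) (Real.exp_pos S).le
      have m2 := mul_le_mul_of_nonneg_left (e' o) (Real.exp_pos (-S)).le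
      rw [Real.cosh_eq S, Real.sinh_eq S]
      have : (Real.exp S * (Real.cosh B + D o / B * Real.sinh B) + Real.exp (-S) * (Real.cosh B - D o / B * Real.sinh B)) / 2 = (Real.exp S + Real.exp (-S)) / 2 * Real.cosh B + D o * ((Real.exp S - Real.exp (-S)) / 2 * Real.sinh B / B) := by
        ring
      linarith
    calc _ ≤ p o * (Real.cosh S * Real.cosh B +
        D o * (Real.sinh S * Real.sinh B / B)) := mul_le_mul_of_nonneg_left this (hp o)
      _ = _ := by ring
  refine (Finset.sum_le_sum fun o _ => h o).trans ?_
  rw [Finset.sum_add_distrib, ← Finset.sum_mul, ← Finset.sum_mul, hp1, h0]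
  simp

lemma greedy {O Λ : Type*} [Fintype O] [Fintype Λ] (p : O → ℝ) (hp : ∀ o, 0 ≤ p o)
    (hp1 : ∑ o, p o = 1) (D : Λ → O → ℝ) (B : ℝ) (hB : 0 < B) (hD : ∀ l o, |D l o| ≤ B)
    (h0 : ∀ l, ∑ o, p o * D l o = 0) (q : ℕ) :
    ∃ w : Fin q → O, ∑ l, Real.cosh (∑ t, D l (w t)) ≤ Fintype.card Λ * Real.cosh B ^ q := by
  induction q with
  | zero => exact ⟨Fin.elim0, by simp⟩
  | succ q ih =>
    obtain ⟨w, hw⟩ := ih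
    have hsum : ∑ o, p o * ∑ l, Real.cosh ((∑ t, D l (w t)) + D l o) ≤
        Fintype.card Λ * Real.cosh B ^ (q + 1) := by
      simp_rw [Finset.mul_sum]
      rw [Finset.sum_comm]
      refine (Finset.sum_le_sum fun l _ => cosh_step p hp hp1 (D l) B hB (hD l) (h0 l) _).trans ?_
      rw [← Finset.sum_mul, pow_succ, ← mul_assoc]
      exact mul_le_mul_of_nonneg_right hw (Real.cosh_pos _).le
    have : ∃ o, ∑ l, Real.cosh ((∑ t, D l (w t)) + D l o) ≤
        Fintype.card Λ * Real.cosh B ^ (q + 1) := by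
      by_contra hcon
      push Not at hcon
      have h2 : ∑ o, p o * (Fintype.card Λ * Real.cosh B ^ (q + 1)) <
          ∑ o, p o * ∑ l, Real.cosh ((∑ t, D l (w t)) + D l o) := by
        apply Finset.sum_lt_sum
        · intro o _; exact mul_le_mul_of_nonneg_left (hcon o).le (hp o)
        · by_contra hne
          push Not at hne
          have : ∀ o, p o = 0 := by
            intro o
            by_contra h
            have hpo : 0 < p o := lt_of_le_of_ne (hp o) (Ne.symm h)
            have := hne o (Finset.mem_univ _)
            have := mul_lt_mul_of_pos_left (hcon o) hpo
            linarith
          simp [this] at hp1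
      rw [← Finset.sum_mul, hp1, one_mul] at h2
      linarith
    obtain ⟨o, ho⟩ := this
    refine ⟨Fin.snoc w o, ?_⟩
    simpa [Fin.sum_univ_castSucc] using ho

lemma maurey {ι Λ : Type*} [Fintype ι] [Fintype Λ] [Nonempty ι] [Nonempty Λ]
    (a : Λ → ι → ℝ) (K r : ℝ) (hK : 0 < K) (hr : 0 < r) (ha : ∀ l i, |a l i| ≤ K)
    (x : ι → ℝ) (hx : ∑ i, |x i| ≤ r) (q : ℕ) (hq : 0 < q) :
    ∃ w : Fin q → ι × Bool, ∀ l,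
      |∑ i, a l i * x i - (r / q) * ∑ t, sg (w t).2 * a l (w t).1| ≤
        2 * r * K * Real.sqrt (2 * Real.log (2 * Fintype.card Λ)) / Real.sqrt q := by
  set N : ℝ := (Fintype.card ι : ℝ) with hN
  have hNpos : 0 < N := by rw [hN]; exact_mod_cast Fintype.card_pos
  set τ : ℝ := (1 - (∑ i, |x i|) / r) / N with hτ
  have hτ0 : 0 ≤ τ := by
    apply div_nonneg _ hNpos.le
    rw [sub_nonneg, div_le_one hr]; exact hx
  set p : ι × Bool → ℝ := fun o => (|x o.1| / r + τ + sg o.2 * x o.1 / r) / 2 with hpdef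
  have hp : ∀ o, 0 ≤ p o := by
    rintro ⟨i, b⟩
    have h1 : 0 ≤ (|x i| + sg b * x i) / r := by
      apply div_nonneg _ hr.le
      cases b <;> simp [sg] <;> linarith [neg_abs_le (x i), le_abs_self (x i)]
    have : p (i, b) = ((|x i| + sg b * x i) / r + τ) / 2 := by simp only [hpdef]; ring
    rw [this]; linarith
  have hp1 : ∑ o, p o = 1 := by
    rw [Fintype.sum_prod_type]
    have : ∀ i, ∑ b : Bool, p (i, b) = |x i| / r + τ := by
      intro i; simp [hpdef, sg]; ring
    simp_rw [this]
    rw [Finset.sum_add_distrib, ← Finset.sum_div]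
    simp only [Finset.sum_const, Finset.card_univ, nsmul_eq_mul]
    rw [hτ, ← hN]; field_simp; ring
  have hmean : ∀ l, ∑ o, p o * (sg o.2 * a l o.1) = (∑ i, a l i * x i) / r := by
    intro l
    rw [Fintype.sum_prod_type, Finset.sum_div]
    refine Finset.sum_congr rfl fun i _ => ?_
    simp [hpdef, sg]; ring
  set y : Λ → ℝ := fun l => (∑ i, a l i * x i) / r with hy
  have hsgb : ∀ b, |sg b| = 1 := by intro b; cases b <;> simp [sg]
  have hyK : ∀ l, |y l| ≤ K := by
    intro l
    rw [hy]; simp only; rw [abs_div, abs_of_pos hr, div_le_iff₀ hr]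
    calc |∑ i, a l i * x i| ≤ ∑ i, |a l i * x i| := Finset.abs_sum_le_sum_abs _ _
      _ ≤ ∑ i, K * |x i| := Finset.sum_le_sum fun i _ => by
          rw [abs_mul]; exact mul_le_mul_of_nonneg_right (ha l i) (abs_nonneg _)
      _ = K * ∑ i, |x i| := by rw [Finset.mul_sum]
      _ ≤ K * r := mul_le_mul_of_nonneg_left hx hK.le
  have hcard : (1:ℝ) ≤ Fintype.card Λ := by exact_mod_cast Fintype.card_pos
  set A : ℝ := Real.log (2 * Fintype.card Λ) with hA
  have hApos : 0 < A := Real.log_pos (by linarith)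
  have hqpos : (0:ℝ) < q := by exact_mod_cast hq
  set lam : ℝ := Real.sqrt (2 * A / q) / (2 * K) with hlam
  have hlpos : 0 < lam := by
    apply div_pos (Real.sqrt_pos.2 (by positivity)) (by linarith)
  obtain ⟨w, hw⟩ := greedy p hp hp1 (fun l o => lam * (y l - sg o.2 * a l o.1)) (lam * (2 * K))
    (by positivity)
    (by
      intro l o
      rw [abs_mul, abs_of_pos hlpos]
      apply mul_le_mul_of_nonneg_left _ hlpos.le
      refine (abs_sub _ _).trans ?_
      rw [abs_mul, hsgb]; linarith [hyK l, ha l o.1])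
    (by
      intro l
      have : ∀ o : ι × Bool, p o * (lam * (y l - sg o.2 * a l o.1)) =
        lam * y l * p o - lam * (p o * (sg o.2 * a l o.1)) := fun o => by ring
      simp_rw [this]
      rw [Finset.sum_sub_distrib, ← Finset.mul_sum, ← Finset.mul_sum, hp1, hmean l]; ring) q
  refine ⟨w, fun l => ?_⟩
  have hb : Real.cosh (∑ t, lam * (y l - sg (w t).2 * a l (w t).1)) ≤
      Fintype.card Λ * Real.cosh (lam * (2 * K)) ^ q :=
    (Finset.single_le_sum (f := fun l => Real.cosh (∑ t, lam * (y l - sg (w t).2 * a l (w t).1)))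
      (fun l _ => (Real.cosh_pos _).le) (Finset.mem_univ l)).trans hw
  have es : ∑ t, lam * (y l - sg (w t).2 * a l (w t).1) =
      lam * (q / r) * (∑ i, a l i * x i - (r / q) * ∑ t, sg (w t).2 * a l (w t).1) := by
    rw [← Finset.mul_sum, Finset.sum_sub_distrib]
    simp only [Finset.sum_const, Finset.card_univ, nsmul_eq_mul, Fintype.card_fin, hy]
    field_simp
  rw [es] at hb
  set E := ∑ i, a l i * x i - (r / q) * ∑ t, sg (w t).2 * a l (w t).1 with hE
  have hl2 : (lam * (2 * K)) = Real.sqrt (2 * A / q) := by rw [hlam]; field_simp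
  have hexp : Real.exp (lam * (q / r) * |E|) ≤ Real.exp (2 * A) := by
    have h1 : Real.exp (lam * (q / r) * |E|) ≤ 2 * Real.cosh (lam * (q / r) * E) := by
      rw [← Real.cosh_abs, abs_mul, abs_of_pos (by positivity : 0 < lam * (q / r)), Real.cosh_eq]
      linarith [Real.exp_pos (-(lam * (q / r) * |E|))]
    have h2 : Real.cosh (lam * (2 * K)) ^ q ≤ Real.exp A := by
      calc _ ≤ (Real.exp ((lam * (2 * K)) ^ 2 / 2)) ^ q :=
            pow_le_pow_left₀ (Real.cosh_pos _).le (Real.cosh_le_exp_half_sq _) _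
        _ = Real.exp A := by
            rw [← Real.exp_nat_mul, hl2, Real.sq_sqrt (by positivity)]
            congr 1; field_simp
    have h3 : Real.exp (2 * A) = (2 * Fintype.card Λ) * Real.exp A := by
      rw [two_mul, Real.exp_add]; congr 1
      rw [hA, Real.exp_log (by linarith)]
    rw [h3]
    have := mul_le_mul_of_nonneg_left h2 (by linarith : (0:ℝ) ≤ Fintype.card Λ)
    linarith
  rw [Real.exp_le_exp] at hexp
  have hsqq : Real.sqrt q ^ 2 = q := Real.sq_sqrt hqpos.le
  have hsA : Real.sqrt (2 * A) ^ 2 = 2 * A := Real.sq_sqrt (by positivity)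
  have hsqpos : 0 < Real.sqrt q := Real.sqrt_pos.2 hqpos
  have hsApos : 0 < Real.sqrt (2 * A) := Real.sqrt_pos.2 (by positivity)
  have hl3 : lam = Real.sqrt (2 * A) / Real.sqrt q / (2 * K) := by
    rw [hlam, Real.sqrt_div (by positivity)]
  have key : lam * (q / r) * |E| ≤ lam * (q / r) *
      (2 * r * K * Real.sqrt (2 * A) / Real.sqrt q) := by
    refine hexp.trans (le_of_eq ?_)
    rw [hl3]
    have : (q:ℝ) = Real.sqrt q ^ 2 := hsqq.symm
    nth_rewrite 2 [this]
    nth_rewrite 1 [← hsA]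
    field_simp
  exact le_of_mul_le_mul_left key (by positivity)

lemma fdiff {Λ J : Type*} [Fintype Λ] [Fintype J] [DecidableEq J] (c : Λ → J)
    (hfib : ∀ j, (Finset.univ.filter (fun l => c l = j)).card ≤ 4) (u v : Λ → ℝ) (d R : ℝ)
    (hd : ∀ l, |u l - v l| ≤ d) (hu : ∑ l, u l ^ 2 ≤ R ^ 2) (hv : ∑ l, v l ^ 2 ≤ R ^ 2) :
    ∑ j, (∑ l with c l = j, u l ^ 2 - ∑ l with c l = j, v l ^ 2) ^ 2 ≤ (4 * d * R) ^ 2 := by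
  have h1 : ∀ j, (∑ l with c l = j, u l ^ 2 - ∑ l with c l = j, v l ^ 2) ^ 2 ≤
      4 * ∑ l with c l = j, (u l ^ 2 - v l ^ 2) ^ 2 := by
    intro j
    rw [← Finset.sum_sub_distrib]
    refine (sq_sum_le_card_mul_sum_sq).trans ?_
    apply mul_le_mul_of_nonneg_right
    · exact_mod_cast hfib j
    · exact Finset.sum_nonneg fun _ _ => sq_nonneg _
  refine (Finset.sum_le_sum fun j _ => h1 j).trans ?_
  rw [← Finset.mul_sum, Finset.sum_fiberwise]
  have h2 : ∀ l, (u l ^ 2 - v l ^ 2) ^ 2 ≤ d ^ 2 * (2 * u l ^ 2 + 2 * v l ^ 2) := by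
    intro l
    have e1 : (u l - v l) ^ 2 ≤ d ^ 2 := by
      rw [← sq_abs]; exact pow_le_pow_left₀ (abs_nonneg _) (hd l) 2
    have e2 : (u l + v l) ^ 2 ≤ 2 * u l ^ 2 + 2 * v l ^ 2 := by nlinarith [sq_nonneg (u l - v l)]
    calc _ = (u l - v l) ^ 2 * (u l + v l) ^ 2 := by ring
      _ ≤ _ := mul_le_mul e1 e2 (sq_nonneg _) (sq_nonneg _)
  have h3 : ∑ l, (u l ^ 2 - v l ^ 2) ^ 2 ≤ d ^ 2 * (4 * R ^ 2) := by
    refine (Finset.sum_le_sum fun l _ => h2 l).trans ?_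
    rw [← Finset.mul_sum, Finset.sum_add_distrib, ← Finset.mul_sum, ← Finset.mul_sum]
    exact mul_le_mul_of_nonneg_left (by linarith) (sq_nonneg _)
  nlinarith [h3]

lemma tail_bound {Λ : Type*} [Fintype Λ] (e : Λ → ℝ) (he : ∀ l, |e l| ≤ 1) (u v : Λ → ℝ)
    (d R : ℝ) (hd0 : 0 ≤ d) (hR : 0 ≤ R)
    (hd : ∀ l, |u l - v l| ≤ d) (hu : ∑ l, u l ^ 2 ≤ R ^ 2) (hv : ∑ l, v l ^ 2 ≤ R ^ 2) :
    |∑ l, e l * u l ^ 2 - ∑ l, e l * v l ^ 2| ≤ d * (Fintype.card Λ * (2 * R)) := by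
  rw [← Finset.sum_sub_distrib]
  refine (Finset.abs_sum_le_sum_abs _ _).trans ?_
  have single : ∀ (w : Λ → ℝ), ∑ l, w l ^ 2 ≤ R ^ 2 → ∀ l, |w l| ≤ R := by
    intro w hw l
    refine abs_le_of_sq_le_sq ?_ hR
    exact (Finset.single_le_sum (f := fun l => w l ^ 2) (fun l _ => sq_nonneg _)
      (Finset.mem_univ l)).trans hw
  have : ∀ l ∈ Finset.univ, |e l * u l ^ 2 - e l * v l ^ 2| ≤ d * (2 * R) := by
    intro l _
    have : e l * u l ^ 2 - e l * v l ^ 2 = e l * ((u l - v l) * (u l + v l)) := by ring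
    rw [this, abs_mul, abs_mul]
    have h1 := single u hu l
    have h2 := single v hv l
    have h3 : |u l + v l| ≤ 2 * R := (abs_add_le _ _).trans (by linarith)
    calc _ ≤ 1 * (|u l - v l| * |u l + v l|) :=
          mul_le_mul_of_nonneg_right (he l) (by positivity)
      _ ≤ _ := by
        rw [one_mul]; exact mul_le_mul (hd l) h3 (abs_nonneg _) hd0
  refine (Finset.sum_le_card_nsmul _ _ _ this).trans ?_
  rw [nsmul_eq_mul, Finset.card_univ]; apply le_of_eq; ring

lemma chain {ι Λ J : Type*} [Fintype ι] [Fintype Λ] [Fintype J] [DecidableEq J] [Nonempty ι]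
    [Nonempty Λ] (a : Λ → ι → ℝ) (c : Λ → J)
    (hfib : ∀ j, (Finset.univ.filter (fun l => c l = j)).card ≤ 4)
    (K r R : ℝ) (hK : 0 < K) (hr : 0 < r) (hR : 0 < R) (ha : ∀ l i, |a l i| ≤ K)
    (T : Set (ι → ℝ)) (hT1 : ∀ x ∈ T, ∑ i, |x i| ≤ r)
    (hTR : ∀ x ∈ T, ∑ l, (∑ i, a l i * x i) ^ 2 ≤ R ^ 2)
    (X : (J → Bool) → (ι → ℝ)) (hX : ∀ ε, X ε ∈ T) (k0 : ℕ) (hk0 : Fintype.card Λ ≤ 2 ^ k0) :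
    ∑ ε : J → Bool, |∑ l, sg (ε (c l)) * (∑ i, a l i * X ε i) ^ 2| ≤
      2 ^ Fintype.card J * (((k0 : ℝ) + 2) *
        (12 * (2 * r * K * Real.sqrt (2 * Real.log (2 * Fintype.card Λ))) * R *
          Real.sqrt (12 * Real.log (2 * Fintype.card ι)))) := by
  classical
  set β := 2 * r * K * Real.sqrt (2 * Real.log (2 * Fintype.card Λ)) with hβ
  set al : Λ → (ι → ℝ) → ℝ := fun l x => ∑ i, a l i * x i with hal
  set Lg := Real.log (2 * Fintype.card ι) with hLg
  have hN1 : (1:ℝ) ≤ Fintype.card ι := by exact_mod_cast Fintype.card_pos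
  have hM1 : (1:ℝ) ≤ Fintype.card Λ := by exact_mod_cast Fintype.card_pos
  have hlog2 : Real.log 2 ≤ Lg := Real.log_le_log (by norm_num) (by linarith)
  have hlog2' : Real.log 2 ≤ Real.log (2 * Fintype.card Λ) :=
    Real.log_le_log (by norm_num) (by linarith)
  have hl2 := Real.log_two_gt_d9
  have hs1 : 1 ≤ Real.sqrt (2 * Real.log (2 * Fintype.card Λ)) := by
    rw [Real.one_le_sqrt]; linarith
  have hs2 : 1 ≤ Real.sqrt (12 * Lg) := by
    rw [Real.one_le_sqrt]; linarith
  have hrK : 0 < r * K := mul_pos hr hK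
  have hβpos : 0 < β := by rw [hβ]; positivity
  have hβr : r * K ≤ β := by
    rw [hβ]; nlinarith
  set W := 12 * β * R * Real.sqrt (12 * Lg) with hW
  -- codes
  have hcode : ∀ (k : ℕ) (x : ι → ℝ), ∃ w : Fin (4 ^ k) → ι × Bool, x ∈ T → ∀ l,
      |al l x - (r / (4 ^ k : ℕ)) * ∑ t, sg (w t).2 * a l (w t).1| ≤ β / 2 ^ k := by
    intro k x
    by_cases hx : x ∈ T
    · obtain ⟨w, hw⟩ := maurey a K r hK hr ha x (hT1 x hx) (4 ^ k) (by positivity)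
      refine ⟨w, fun _ l => ?_⟩
      have := hw l
      have e : Real.sqrt ((4 ^ k : ℕ) : ℝ) = 2 ^ k := by
        have : (((4 ^ k : ℕ) : ℝ)) = (2 ^ k) ^ 2 := by
          push_cast; rw [← pow_mul, mul_comm, pow_mul]; norm_num
        rw [this, Real.sqrt_sq (by positivity)]
      rwa [e] at this
    · obtain ⟨i⟩ := ‹Nonempty ι›
      exact ⟨fun _ => (i, true), fun h => absurd h hx⟩
  choose code hcode using hcode
  -- representatives
  have hrep : ∀ (k : ℕ) (w : Fin (4 ^ k) → ι × Bool), ∃ z : ι → ℝ,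
      (∃ x ∈ T, code k x = w) → z ∈ T ∧ code k z = w := by
    intro k w
    by_cases h : ∃ x ∈ T, code k x = w
    · obtain ⟨x, hx, hxw⟩ := h
      exact ⟨x, fun _ => ⟨hx, hxw⟩⟩
    · exact ⟨0, fun h' => absurd h' h⟩
  choose rep hrep using hrep
  set P : ℕ → (ι → ℝ) → (ι → ℝ) := fun k x => rep k (code k x) with hP
  have hPT : ∀ k x, x ∈ T → P k x ∈ T := fun k x hx => (hrep k _ ⟨x, hx, rfl⟩).1
  have hPd : ∀ k x, x ∈ T → ∀ l, |al l x - al l (P k x)| ≤ 2 * (β / 2 ^ k) := by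
    intro k x hx l
    have h1 := hcode k x hx l
    have h2 := hcode k (P k x) (hPT k x hx) l
    have h3 : code k (P k x) = code k x := (hrep k _ ⟨x, hx, rfl⟩).2
    rw [h3] at h2
    rw [abs_le] at *
    constructor <;> linarith [h1.1, h1.2, h2.1, h2.2]
  set F : (J → Bool) → (ι → ℝ) → ℝ := fun ε x => ∑ l, sg (ε (c l)) * (al l x) ^ 2 with hF
  set f : (ι → ℝ) → J → ℝ := fun x j => ∑ l with c l = j, (al l x) ^ 2 with hf
  have hFf : ∀ ε x, F ε x = ∑ j, sg (ε j) * f x j := by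
    intro ε x
    simp only [hF, hf]
    rw [← Finset.sum_fiberwise Finset.univ c]
    refine Finset.sum_congr rfl fun j _ => ?_
    rw [Finset.mul_sum]
    refine Finset.sum_congr rfl fun l hl => ?_
    rw [(Finset.mem_filter.1 hl).2]
  -- level zero
  have hcardcode : ∀ k : ℕ, (Fintype.card (Fin (4 ^ k) → ι × Bool) : ℝ) =
      (2 * Fintype.card ι) ^ (4 ^ k) := by
    intro k; simp [mul_comm]
  have hbase : ∑ ε : J → Bool, |F ε (P 0 (X ε))| ≤ 2 ^ Fintype.card J * W := by
    have := max_ineq (I := Fin (4 ^ 0) → ι × Bool) (fun w => f (rep 0 w)) (4 * β * R) (2 * Lg)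
      (by positivity) (by linarith)
      (by
        rw [hcardcode, pow_zero, pow_one, Real.log_mul (by norm_num) (by linarith)]; linarith)
      (fun ε => code 0 (X ε))
      (by
        intro ε
        have hz := hPT 0 _ (hX ε)
        have := fdiff c hfib (fun l => al l (P 0 (X ε))) (fun _ => 0) β R
          (by
            intro l
            simp only [sub_zero, hal]
            refine (Finset.abs_sum_le_sum_abs _ _).trans ?_
            calc _ ≤ ∑ i, K * |P 0 (X ε) i| := Finset.sum_le_sum fun i _ => by
                  rw [abs_mul]; exact mul_le_mul_of_nonneg_right (ha l i) (abs_nonneg _)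
              _ = K * ∑ i, |P 0 (X ε) i| := by rw [Finset.mul_sum]
              _ ≤ K * r := mul_le_mul_of_nonneg_left (hT1 _ hz) hK.le
              _ ≤ β := by rw [mul_comm]; exact hβr)
          (hTR _ hz) (by simp; positivity)
        simpa using this)
    simp_rw [hFf]
    refine this.trans ?_
    apply mul_le_mul_of_nonneg_left _ (by positivity)
    have : Real.sqrt (2 * (2 * Lg)) ≤ Real.sqrt (12 * Lg) := Real.sqrt_le_sqrt (by linarith)
    rw [hW]
    have h0 : 0 ≤ β * R := by positivity
    nlinarith [mul_le_mul_of_nonneg_left this h0, mul_nonneg h0 (Real.sqrt_nonneg (12 * Lg))]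
  have hlevel : ∀ k, ∑ ε : J → Bool, |F ε (P (k+1) (X ε)) - F ε (P k (X ε))| ≤
      2 ^ Fintype.card J * W := by
    intro k
    have := max_ineq (I := (Fin (4 ^ (k+1)) → ι × Bool) × (Fin (4 ^ k) → ι × Bool))
      (fun w j => f (rep (k+1) w.1) j - f (rep k w.2) j) (4 * (3 * (β / 2 ^ k)) * R)
      (6 * 4 ^ k * Lg)
      (by positivity) (by
        have : (0:ℝ) < 4 ^ k := by positivity
        have : 0 < Lg := by linarith
        positivity)
      (by
        rw [Fintype.card_prod, Nat.cast_mul, hcardcode, hcardcode, ← pow_add,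
          Real.log_mul (by norm_num) (by positivity), Real.log_pow]
        have : (1:ℝ) ≤ 4 ^ k := one_le_pow₀ (by norm_num)
        push_cast
        rw [pow_succ, ← hLg]
        nlinarith)
      (fun ε => (code (k+1) (X ε), code k (X ε)))
      (by
        intro ε
        refine fdiff c hfib (fun l => al l (P (k+1) (X ε))) (fun l => al l (P k (X ε))) _ R
          (fun l => ?_) (hTR _ (hPT _ _ (hX ε))) (hTR _ (hPT _ _ (hX ε)))
        have h1 := hPd (k+1) _ (hX ε) l
        have h2 := hPd k _ (hX ε) l
        have e : 2 * (β / 2 ^ (k+1)) = β / 2 ^ k := by rw [pow_succ]; field_simp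
        rw [e] at h1
        rw [abs_le] at *
        constructor <;> linarith [h1.1, h1.2, h2.1, h2.2])
    have e : ∀ ε : J → Bool, F ε (P (k+1) (X ε)) - F ε (P k (X ε)) =
        ∑ j, sg (ε j) * (f (P (k+1) (X ε)) j - f (P k (X ε)) j) := by
      intro ε
      rw [hFf, hFf, ← Finset.sum_sub_distrib]
      exact Finset.sum_congr rfl fun j _ => by ring
    simp_rw [e]
    refine this.trans (le_of_eq ?_)
    congr 1
    have : Real.sqrt (2 * (6 * 4 ^ k * Lg)) = 2 ^ k * Real.sqrt (12 * Lg) := by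
      have h4 : 2 * (6 * 4 ^ k * Lg) = (2 ^ k) ^ 2 * (12 * Lg) := by
        have : ((2:ℝ) ^ k) ^ 2 = 4 ^ k := by rw [← pow_mul, mul_comm, pow_mul]; norm_num
        rw [this]; ring
      rw [h4, Real.sqrt_mul (by positivity), Real.sqrt_sq (by positivity)]
    rw [this, hW]; field_simp; ring
  have htail : ∀ ε : J → Bool, |F ε (X ε) - F ε (P k0 (X ε))| ≤ W := by
    intro ε
    have := tail_bound (fun l => sg (ε (c l))) (fun l => by
      cases ε (c l) <;> simp [sg]) (fun l => al l (X ε)) (fun l => al l (P k0 (X ε)))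
      (2 * (β / 2 ^ k0)) R (by positivity) hR.le (hPd k0 _ (hX ε)) (hTR _ (hX ε))
      (hTR _ (hPT _ _ (hX ε)))
    refine this.trans ?_
    have h2 : (Fintype.card Λ : ℝ) ≤ 2 ^ k0 := by exact_mod_cast hk0
    calc 2 * (β / 2 ^ k0) * (Fintype.card Λ * (2 * R))
        ≤ 2 * (β / 2 ^ k0) * (2 ^ k0 * (2 * R)) := by gcongr
      _ = 4 * (β * R) := by field_simp; ring
      _ ≤ W := by
        rw [hW]
        have h0 : 0 ≤ β * R := by positivity
        nlinarith [mul_le_mul_of_nonneg_left hs2 h0]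
  -- telescoping
  have htel : ∀ k, ∑ ε : J → Bool, |F ε (P k (X ε))| ≤ 2 ^ Fintype.card J * ((k + 1) * W) := by
    intro k
    induction k with
    | zero => simpa using hbase
    | succ k ih =>
      have : ∀ ε : J → Bool, |F ε (P (k+1) (X ε))| ≤
          |F ε (P k (X ε))| + |F ε (P (k+1) (X ε)) - F ε (P k (X ε))| := by
        intro ε
        have := abs_add_le (F ε (P k (X ε))) (F ε (P (k+1) (X ε)) - F ε (P k (X ε)))
        simpa using this
      refine (Finset.sum_le_sum fun ε _ => this ε).trans ?_
      rw [Finset.sum_add_distrib]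
      have := hlevel k
      push_cast
      linarith
  have hfin : ∀ ε : J → Bool, |F ε (X ε)| ≤ |F ε (P k0 (X ε))| + W := by
    intro ε
    have := abs_add_le (F ε (P k0 (X ε))) (F ε (X ε) - F ε (P k0 (X ε)))
    have h2 := htail ε
    have h3 : F ε (P k0 (X ε)) + (F ε (X ε) - F ε (P k0 (X ε))) = F ε (X ε) := by ring
    rw [h3] at this; linarith
  refine (Finset.sum_le_sum fun ε _ => hfin ε).trans ?_
  rw [Finset.sum_add_distrib]
  have := htel k0
  simp only [Finset.sum_const, Finset.card_univ, nsmul_eq_mul, Fintype.card_fun,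
      Fintype.card_bool]
  push_cast
  linarith

noncomputable def gm (P M : Type*) [Fintype P] [Fintype M] (v : NNReal) : Measure (P → M → ℝ) :=
  Measure.pi fun _ => Measure.pi fun _ => gaussianReal 0 v

instance gm_prob (P M : Type*) [Fintype P] [Fintype M] (v : NNReal) :
    IsProbabilityMeasure (gm P M v) := by unfold gm; infer_instance

lemma gm_cf {P M : Type*} [Fintype P] [Fintype M] (v : NNReal) (α : P → M → ℝ) :
    ∫ φ, Complex.exp ((∑ i, ∑ t, α i t * φ i t : ℝ) * Complex.I) ∂(gm P M v) =
      Complex.exp (-(v * ∑ i, ∑ t, α i t ^ 2 / 2 : ℝ)) := by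
  have h1 : ∀ φ : P → M → ℝ, Complex.exp ((∑ i, ∑ t, α i t * φ i t : ℝ) * Complex.I) =
      ∏ i, ∏ t, Complex.exp ((α i t) * (φ i t) * Complex.I) := by
    intro φ
    push_cast
    simp_rw [Finset.sum_mul, Complex.exp_sum]
  simp_rw [h1]
  unfold gm
  rw [integral_fintype_prod_eq_prod (𝕜 := ℂ)
    (f := fun (i : P) (x : M → ℝ) => ∏ t, Complex.exp ((α i t) * (x t) * Complex.I))]
  have h2 : ∀ i, ∫ (x : M → ℝ), ∏ t, Complex.exp ((α i t) * (x t) * Complex.I)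
      ∂(Measure.pi fun _ => gaussianReal 0 v) =
      ∏ t, Complex.exp (-(v * (α i t ^ 2 / 2 : ℝ))) := by
    intro i
    rw [integral_fintype_prod_eq_prod (𝕜 := ℂ)
      (f := fun (t : M) (x : ℝ) => Complex.exp ((α i t) * x * Complex.I))]
    refine Finset.prod_congr rfl fun t _ => ?_
    rw [← charFun_apply_real, charFun_gaussianReal]
    congr 1; push_cast; ring
  simp_rw [h2, ← Complex.exp_sum]
  congr 1
  push_cast
  rw [Finset.mul_sum, ← Finset.sum_neg_distrib]
  refine Finset.sum_congr rfl fun i _ => ?_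
  rw [Finset.mul_sum, ← Finset.sum_neg_distrib]

noncomputable def Wmap {P M : Type*} [Fintype M] (U : Matrix M M ℝ)
    (z : (P → M → ℝ) × (P → M → ℝ)) : (P → M → ℝ) × (P → M → ℝ) :=
  (fun i t => (z.1 i t + z.2 i t + ∑ u, U t u * (z.1 i u - z.2 i u)) / 2,
   fun i t => (z.1 i t + z.2 i t - ∑ u, U t u * (z.1 i u - z.2 i u)) / 2)

lemma Wmap_cont {P M : Type*} [Fintype M] (U : Matrix M M ℝ) :
    Continuous (Wmap (P := P) U) := by
  unfold Wmap
  fun_prop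

lemma U_iso {M : Type*} [Fintype M] [DecidableEq M] (U : Matrix M M ℝ) (hs : Uᵀ = U)
    (h2 : U * U = 1) (x : M → ℝ) : ∑ t, (∑ u, U t u * x u) ^ 2 = ∑ t, x t ^ 2 := by
  have : (U *ᵥ x) ⬝ᵥ (U *ᵥ x) = x ⬝ᵥ x := by
    rw [Matrix.dotProduct_mulVec, Matrix.vecMul_mulVec, hs, h2, Matrix.vecMul_one]
  simpa [dotProduct, Matrix.mulVec, sq] using this

lemma gm_prod_cf {P M : Type*} [Fintype P] [Fintype M] (v : NNReal) (α β : P → M → ℝ) :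
    ∫ z : (P → M → ℝ) × (P → M → ℝ),
      Complex.exp ((∑ i, ∑ t, (α i t * z.1 i t + β i t * z.2 i t) : ℝ) * Complex.I)
        ∂((gm P M v).prod (gm P M v)) =
      Complex.exp (-(v * ∑ i, ∑ t, (α i t ^ 2 + β i t ^ 2) / 2 : ℝ)) := by
  have : ∀ z : (P → M → ℝ) × (P → M → ℝ),
      Complex.exp ((∑ i, ∑ t, (α i t * z.1 i t + β i t * z.2 i t) : ℝ) * Complex.I) =
      Complex.exp ((∑ i, ∑ t, α i t * z.1 i t : ℝ) * Complex.I) *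
      Complex.exp ((∑ i, ∑ t, β i t * z.2 i t : ℝ) * Complex.I) := by
    intro z
    rw [← Complex.exp_add]
    congr 1
    simp_rw [Finset.sum_add_distrib]
    push_cast; ring
  simp_rw [this]
  rw [integral_prod_mul (fun x : P → M → ℝ => Complex.exp ((∑ i, ∑ t, α i t * x i t : ℝ) * Complex.I))
    (fun y : P → M → ℝ => Complex.exp ((∑ i, ∑ t, β i t * y i t : ℝ) * Complex.I)), gm_cf, gm_cf,
    ← Complex.exp_add]
  congr 1
  simp_rw [add_div, Finset.sum_add_distrib]
  push_cast; ring

lemma gm_invariant {P M : Type*} [Fintype P] [Fintype M] [DecidableEq P] [DecidableEq M]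
    (v : NNReal) (U : Matrix M M ℝ) (hs : Uᵀ = U) (h2 : U * U = 1) :
    ((gm P M v).prod (gm P M v)).map (Wmap U) = (gm P M v).prod (gm P M v) := by
  have := Measure.isProbabilityMeasure_map (μ := (gm P M v).prod (gm P M v))
    (Wmap_cont (P := P) U).measurable.aemeasurable
  apply Measure.ext_of_charFunDual
  ext L
  rw [charFunDual_apply, charFunDual_apply]
  set α : P → M → ℝ := fun i t => L (Pi.single i (Pi.single t 1), 0) with hα
  set β : P → M → ℝ := fun i t => L (0, Pi.single i (Pi.single t 1)) with hβ
  have hdec : ∀ x : P → M → ℝ, x = ∑ i, ∑ t, x i t • Pi.single i (Pi.single t (1:ℝ)) := by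
    intro x
    ext i t
    simp [Finset.sum_apply, Pi.single_apply, Finset.sum_ite_eq, apply_ite, ite_apply]
  have hL : ∀ z, L z = ∑ i, ∑ t, (α i t * z.1 i t + β i t * z.2 i t) := by
    intro z
    have h1 : L (z.1, 0) = ∑ i, ∑ t, α i t * z.1 i t := by
      have : L (z.1, 0) = (L.comp (ContinuousLinearMap.inl ℝ _ _)) z.1 := by simp
      rw [this]
      conv_lhs => rw [hdec z.1]
      simp [map_sum, hα, mul_comm]
    have h2 : L (0, z.2) = ∑ i, ∑ t, β i t * z.2 i t := by
      have : L (0, z.2) = (L.comp (ContinuousLinearMap.inr ℝ _ _)) z.2 := by simp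
      rw [this]
      conv_lhs => rw [hdec z.2]
      simp [map_sum, hβ, mul_comm]
    have : z = (z.1, 0) + (0, z.2) := by simp
    conv_lhs => rw [this, map_add, h1, h2]
    simp_rw [Finset.sum_add_distrib]
  rw [integral_map (Wmap_cont U).measurable.aemeasurable (by
    apply Continuous.aestronglyMeasurable; fun_prop)]
  simp_rw [hL]
  rw [gm_prod_cf]
  have hadj : ∀ a b : M → ℝ, ∑ t, a t * ∑ u, U t u * b u = ∑ t, (∑ u, U t u * a u) * b t := by
    intro a b
    have : a ⬝ᵥ (U *ᵥ b) = (U *ᵥ a) ⬝ᵥ b := by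
      rw [Matrix.dotProduct_mulVec, ← Matrix.mulVec_transpose, hs]
    simpa [dotProduct, Matrix.mulVec] using this
  set α' : P → M → ℝ := (Wmap U (α, β)).1 with hα'
  set β' : P → M → ℝ := (Wmap U (α, β)).2 with hβ'
  have hW : ∀ z : (P → M → ℝ) × (P → M → ℝ),
      ∑ i, ∑ t, (α i t * (Wmap U z).1 i t + β i t * (Wmap U z).2 i t) =
      ∑ i, ∑ t, (α' i t * z.1 i t + β' i t * z.2 i t) := by
    intro z
    refine Finset.sum_congr rfl fun i _ => ?_
    have h3 := hadj (fun t => α i t - β i t) (fun t => z.1 i t - z.2 i t)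
    have e1 : ∑ t, (α i t * (Wmap U z).1 i t + β i t * (Wmap U z).2 i t) =
       (∑ t, (α i t + β i t) * (z.1 i t + z.2 i t)) / 2 + (∑ t, (α i t - β i t) * ∑ u, U t u * (z.1 i u - z.2 i u)) / 2 := by
      rw [← add_div, ← Finset.sum_add_distrib, Finset.sum_div]
      refine Finset.sum_congr rfl fun t _ => ?_
      simp only [Wmap]; ring
    have e2 : ∑ t, (α' i t * z.1 i t + β' i t * z.2 i t) =
       (∑ t, (α i t + β i t) * (z.1 i t + z.2 i t)) / 2 + (∑ t, (∑ u, U t u * (α i u - β i u)) * (z.1 i t - z.2 i t)) / 2 := by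
      rw [← add_div, ← Finset.sum_add_distrib, Finset.sum_div]
      refine Finset.sum_congr rfl fun t _ => ?_
      simp only [hα', hβ', Wmap]; ring
    rw [e1, e2, h3]
  simp_rw [hW]
  rw [gm_prod_cf]
  congr 4
  refine Finset.sum_congr rfl fun i _ => ?_
  have h4 := U_iso U hs h2 (fun u => α i u - β i u)
  have e1 : ∑ t, (α' i t ^ 2 + β' i t ^ 2) / 2 =
     (∑ t, (α i t + β i t) ^ 2) / 4 + (∑ t, (∑ u, U t u * (α i u - β i u)) ^ 2) / 4 := by
    rw [← add_div, ← Finset.sum_add_distrib, Finset.sum_div]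
    refine Finset.sum_congr rfl fun t _ => ?_
    simp only [hα', hβ', Wmap]; ring
  rw [e1, h4, ← add_div, ← Finset.sum_add_distrib, Finset.sum_div]
  refine Finset.sum_congr rfl fun t _ => ?_
  ring

noncomputable def ub {m : ℕ} [NeZero m] (l : ZMod m × Bool) (t : ZMod m) : ℝ :=
  (if l.2 then (ZMod.stdAddChar (l.1 * t) : ℂ).re else (ZMod.stdAddChar (l.1 * t) : ℂ).im) /
    Real.sqrt m

noncomputable def Um {m : ℕ} [NeZero m] (e : ZMod m → ℝ) : Matrix (ZMod m) (ZMod m) ℝ :=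
  Matrix.of fun t u => ∑ l : ZMod m × Bool, e l.1 * (ub l t * ub l u)

lemma chi_conj {m : ℕ} [NeZero m] (x : ZMod m) :
    (starRingEnd ℂ) (ZMod.stdAddChar x : ℂ) = ZMod.stdAddChar (-x) := by
  rw [AddChar.map_neg_eq_conj]

lemma chi_norm {m : ℕ} [NeZero m] (x : ZMod m) : ‖(ZMod.stdAddChar x : ℂ)‖ = 1 :=
  AddChar.norm_apply _ _

lemma ub_sum {m : ℕ} [NeZero m] (w t u : ZMod m) :
    ∑ b : Bool, ub (w, b) t * ub (w, b) u = (ZMod.stdAddChar (w * (t - u)) : ℂ).re / m := by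
  have hm : (0:ℝ) < m := by exact_mod_cast Nat.pos_of_ne_zero (NeZero.ne m)
  have hs : Real.sqrt m * Real.sqrt m = m := Real.mul_self_sqrt hm.le
  have : (ZMod.stdAddChar (w * (t - u)) : ℂ) =
      ZMod.stdAddChar (w * t) * (starRingEnd ℂ) (ZMod.stdAddChar (w * u) : ℂ) := by
    rw [chi_conj, ← AddChar.map_add_eq_mul]; congr 1; ring
  rw [this]
  simp only [Fintype.sum_bool, ub, Complex.mul_re, Complex.conj_re, Complex.conj_im]
  simp only [div_mul_div_comm, hs]
  simp
  ring

lemma Um_apply {m : ℕ} [NeZero m] (e : ZMod m → ℝ) (t u : ZMod m) :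
    Um e t u = ∑ w, e w * ((ZMod.stdAddChar (w * (t - u)) : ℂ).re / m) := by
  simp only [Um, Matrix.of_apply, Fintype.sum_prod_type]
  refine Finset.sum_congr rfl fun w _ => ?_
  rw [← Finset.mul_sum, ub_sum]

lemma Um_complex {m : ℕ} [NeZero m] (e : ZMod m → ℝ) (he : ∀ w, e (-w) = e w) (t u : ZMod m) :
    ((Um e t u : ℝ) : ℂ) = (∑ w, (e w : ℂ) * ZMod.stdAddChar (w * (t - u))) / m := by
  have h1 : ∑ w, (e w : ℂ) * ZMod.stdAddChar (w * (t - u)) =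
      ∑ w, (e w : ℂ) * (starRingEnd ℂ) (ZMod.stdAddChar (w * (t - u)) : ℂ) := by
    rw [← Equiv.sum_comp (Equiv.neg (ZMod m))]
    refine Finset.sum_congr rfl fun w _ => ?_
    rw [chi_conj]; simp [he]
  have h2 : ∑ w, (e w : ℂ) * ZMod.stdAddChar (w * (t - u)) =
      ∑ w, (e w : ℂ) * ((ZMod.stdAddChar (w * (t - u)) : ℂ).re : ℂ) := by
    have h3 : ∑ w, (e w : ℂ) * ZMod.stdAddChar (w * (t - u)) =
      (∑ w, (e w : ℂ) * ZMod.stdAddChar (w * (t - u)) + ∑ w, (e w : ℂ) * (starRingEnd ℂ) (ZMod.stdAddChar (w * (t - u)) : ℂ)) / 2 := by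
      rw [← h1]; ring
    rw [h3, ← Finset.sum_add_distrib, Finset.sum_div]
    refine Finset.sum_congr rfl fun w _ => ?_
    rw [Complex.re_eq_add_conj]; ring
  rw [h2, Um_apply]
  push_cast
  rw [Finset.sum_div]
  exact Finset.sum_congr rfl fun w _ => by ring

lemma chi_sum {m : ℕ} [NeZero m] (b : ZMod m) :
    ∑ x : ZMod m, (ZMod.stdAddChar (x * b) : ℂ) = if b = 0 then (m : ℂ) else 0 := by
  have := AddChar.sum_mulShift (R := ZMod m) (R' := ℂ) b (ZMod.isPrimitive_stdAddChar m)
  rw [this]; simp [ZMod.card]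

lemma Um_one {m : ℕ} [NeZero m] : Um (fun _ : ZMod m => (1:ℝ)) = 1 := by
  have hm : (m:ℂ) ≠ 0 := by exact_mod_cast NeZero.ne m
  ext t u
  have : ((Um (fun _ : ZMod m => (1:ℝ)) t u : ℝ) : ℂ) = (((1 : Matrix (ZMod m) (ZMod m) ℝ) t u : ℝ) : ℂ) := by
    rw [Um_complex _ (fun _ => rfl)]
    simp only [Complex.ofReal_one, one_mul, chi_sum, Matrix.one_apply, sub_eq_zero]
    split_ifs <;> simp [hm]
  exact_mod_cast this

lemma Um_sq {m : ℕ} [NeZero m] (e : ZMod m → ℝ) (he : ∀ w, e (-w) = e w)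
    (he2 : ∀ w, e w * e w = 1) : Um e * Um e = 1 := by
  have hm : (m:ℂ) ≠ 0 := by exact_mod_cast NeZero.ne m
  rw [← Um_one]
  ext t v
  have : (((Um e * Um e) t v : ℝ) : ℂ) = ((Um (fun _ : ZMod m => (1:ℝ)) t v : ℝ) : ℂ) := by
    rw [Um_complex _ (fun _ => rfl), Matrix.mul_apply]
    push_cast
    simp_rw [Um_complex e he, div_mul_div_comm, Finset.sum_mul_sum]
    rw [← Finset.sum_div]
    have h1 : ∑ u : ZMod m, ∑ w, ∑ w', (e w : ℂ) * ZMod.stdAddChar (w * (t - u)) *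
        ((e w' : ℂ) * ZMod.stdAddChar (w' * (u - v))) = ∑ w, (m : ℂ) * ZMod.stdAddChar (w * (t - v)) := by
      rw [Finset.sum_comm]
      refine Finset.sum_congr rfl fun w _ => ?_
      rw [Finset.sum_comm]
      have h2 : ∀ w', ∑ u : ZMod m, (e w : ℂ) * ZMod.stdAddChar (w * (t - u)) *
        ((e w' : ℂ) * ZMod.stdAddChar (w' * (u - v))) = if w' = w then (m : ℂ) * ZMod.stdAddChar (w * (t - v)) else 0 := by
        intro w'
        have h3 : ∀ u, (e w : ℂ) * ZMod.stdAddChar (w * (t - u)) *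
          ((e w' : ℂ) * ZMod.stdAddChar (w' * (u - v))) =
            (e w * e w' : ℂ) * ZMod.stdAddChar (w * t - w' * v) * ZMod.stdAddChar (u * (w' - w)) := by
          intro u
          have : (ZMod.stdAddChar (w * (t - u)) : ℂ) * ZMod.stdAddChar (w' * (u - v)) = ZMod.stdAddChar (w * t - w' * v) * ZMod.stdAddChar (u * (w' - w)) := by
            rw [← AddChar.map_add_eq_mul, ← AddChar.map_add_eq_mul]; congr 1; ring
          linear_combination (e w * e w' : ℂ) * this
        simp_rw [h3]
        rw [← Finset.mul_sum, chi_sum]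
        simp only [sub_eq_zero]
        split_ifs with h
        · subst h
          have : (e w' * e w' : ℂ) = 1 := by exact_mod_cast he2 w'
          rw [this, mul_sub]; ring
        · simp
      simp_rw [h2]
      simp
    rw [h1, ← Finset.mul_sum]
    simp only [Complex.ofReal_one, one_mul]
    field_simp
  exact_mod_cast this

lemma Um_symm {m : ℕ} [NeZero m] (e : ZMod m → ℝ) : (Um e)ᵀ = Um e := by
  ext t u
  simp only [Matrix.transpose_apply, Um, Matrix.of_apply]
  exact Finset.sum_congr rfl fun l _ => by ring

lemma Um_circ {m : ℕ} [NeZero m] (e : ZMod m → ℝ) (h t u : ZMod m) :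
    Um e (h + t) (h + u) = Um e t u := by
  rw [Um_apply, Um_apply]; simp

lemma ub_sq_sum {m : ℕ} [NeZero m] (l : ZMod m × Bool) : ∑ t, ub l t ^ 2 ≤ 1 := by
  have hm : (0:ℝ) < m := by exact_mod_cast Nat.pos_of_ne_zero (NeZero.ne m)
  have : ∀ t, ub l t ^ 2 ≤ 1 / m := by
    intro t
    unfold ub
    rw [div_pow, Real.sq_sqrt hm.le]
    apply div_le_div_of_nonneg_right _ hm.le
    have h1 := chi_norm (l.1 * t)
    split_ifs
    · have := Complex.abs_re_le_norm (ZMod.stdAddChar (l.1 * t) : ℂ)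
      rw [h1] at this
      rw [← sq_abs]; exact pow_le_one₀ (abs_nonneg _) this
    · have := Complex.abs_im_le_norm (ZMod.stdAddChar (l.1 * t) : ℂ)
      rw [h1] at this
      rw [← sq_abs]; exact pow_le_one₀ (abs_nonneg _) this
  refine (Finset.sum_le_sum fun t _ => this t).trans ?_
  simp [ZMod.card, hm.ne']

def rr {m : ℕ} (w : ZMod m) : ZMod m := if w.val ≤ (-w).val then w else -w

lemma rr_neg {m : ℕ} [NeZero m] (w : ZMod m) : rr (-w) = rr w := by
  unfold rr
  rw [neg_neg]
  split_ifs with h1 h2 h2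
  · exact ZMod.val_injective m (le_antisymm h1 h2)
  · rfl
  · rfl
  · omega

lemma rr_fib {m : ℕ} [NeZero m] (j : ZMod m) :
    (Finset.univ.filter (fun l : ZMod m × Bool => rr l.1 = j)).card ≤ 4 := by
  have : (Finset.univ.filter (fun l : ZMod m × Bool => rr l.1 = j)) ⊆
      ({j, -j} : Finset (ZMod m)) ×ˢ (Finset.univ : Finset Bool) := by
    intro l hl
    have h := (Finset.mem_filter.1 hl).2
    simp only [Finset.mem_product, Finset.mem_insert, Finset.mem_singleton, Finset.mem_univ,
      and_true]
    unfold rr at h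
    split_ifs at h
    · exact Or.inl h
    · right; rw [← h, neg_neg]
  refine (Finset.card_le_card this).trans ?_
  rw [Finset.card_product]
  have := Finset.card_le_two (a := j) (b := -j)
  simp; omega

/-- the quadratic form of `Um` -/
lemma Um_quad {m : ℕ} [NeZero m] (e : ZMod m → ℝ) (y : ZMod m → ℝ) :
    ∑ t, ∑ u, y t * Um e t u * y u = ∑ l : ZMod m × Bool, e l.1 * (∑ t, ub l t * y t) ^ 2 := by
  simp only [Um, Matrix.of_apply]
  have : ∀ l : ZMod m × Bool, e l.1 * (∑ t, ub l t * y t) ^ 2 =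
      ∑ t, ∑ u, y t * (e l.1 * (ub l t * ub l u)) * y u := by
    intro l
    rw [sq, Finset.sum_mul_sum, Finset.mul_sum]
    refine Finset.sum_congr rfl fun t _ => ?_
    rw [Finset.mul_sum]
    exact Finset.sum_congr rfl fun u _ => by ring
  simp_rw [this]
  rw [Finset.sum_comm]
  conv_rhs => rw [Finset.sum_comm]
  conv_lhs => rw [Finset.sum_comm]
  refine Finset.sum_congr rfl fun t _ => ?_
  conv_rhs => rw [Finset.sum_comm]
  refine Finset.sum_congr rfl fun u _ => ?_
  rw [Finset.mul_sum, Finset.sum_mul]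

lemma pi_int {I E : Type*} [Fintype I] [MeasurableSpace E] (ν : Measure E) [IsProbabilityMeasure ν]
    (i : I) (f : E → ℝ) (hf : Integrable f ν) :
    Integrable (fun x : I → E => f (x i)) (Measure.pi fun _ => ν) :=
  (measurePreserving_eval (fun _ : I => ν) i).integrable_comp_of_integrable hf

lemma pi_integral {I E : Type*} [Fintype I] [MeasurableSpace E] (ν : Measure E)
    [IsProbabilityMeasure ν]
    (i : I) (f : E → ℝ) (hf : AEStronglyMeasurable f ν) :
    ∫ x : I → E, f (x i) ∂(Measure.pi fun _ => ν) = ∫ x, f x ∂ν := by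
  have h := (measurePreserving_eval (fun _ : I => ν) i)
  have h2 : (Measure.pi fun _ : I => ν).map (Function.eval i) = ν := h.map_eq
  have := integral_map (μ := Measure.pi fun _ : I => ν) h.measurable.aemeasurable
    (f := f) (by rw [h2]; exact hf)
  rw [h2] at this
  rw [this]

lemma gauss_sq (v : NNReal) : Integrable (fun x : ℝ => x ^ 2) (gaussianReal 0 v) ∧
    ∫ x, x ^ 2 ∂(gaussianReal 0 v) = v := by
  constructor
  · exact (memLp_id_gaussianReal (μ := 0) (v := v) 2).integrable_sq
  · have h := variance_id_gaussianReal (μ := 0) (v := v)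
    rw [variance_eq_integral measurable_id.aemeasurable] at h
    simpa using h

lemma gm_sq_int {P M : Type*} [Fintype P] [Fintype M] (v : NNReal) (i : P) (t : M) :
    Integrable (fun φ : P → M → ℝ => φ i t ^ 2) (gm P M v) := by
  unfold gm
  exact pi_int _ i (fun x : M → ℝ => x t ^ 2)
    (pi_int _ t (fun x : ℝ => x ^ 2) (gauss_sq v).1)

lemma gm_mul_int {P M : Type*} [Fintype P] [Fintype M] (v : NNReal) (i j : P) (t u : M) :
    Integrable (fun φ : P → M → ℝ => φ i t * φ j u) (gm P M v) := by
  refine ((gm_sq_int v i t).add (gm_sq_int v j u)).mono'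
    (Continuous.aestronglyMeasurable (by fun_prop)) (Filter.Eventually.of_forall fun φ => ?_)
  simp only [Pi.add_apply, Real.norm_eq_abs]
  rw [abs_le]
  constructor <;> nlinarith [sq_nonneg (φ i t + φ j u), sq_nonneg (φ i t - φ j u), sq_nonneg (φ i t), sq_nonneg (φ j u)]

lemma gm_mul {P M : Type*} [Fintype P] [Fintype M] [DecidableEq P] [DecidableEq M]
    (v : NNReal) (i j : P) (t u : M) :
    ∫ φ : P → M → ℝ, φ i t * φ j u ∂(gm P M v) = if i = j ∧ t = u then (v : ℝ) else 0 := by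
  unfold gm
  have z1 : ∀ t : M, ∫ x : M → ℝ, x t ∂(Measure.pi fun _ => gaussianReal 0 v) = 0 := by
    intro t
    rw [pi_integral _ t (fun x : ℝ => x)
      (Continuous.aestronglyMeasurable (by fun_prop)), integral_id_gaussianReal]
  by_cases hij : i = j
  · subst hij
    rw [pi_integral _ i (fun x : M → ℝ => x t * x u)
      (Continuous.aestronglyMeasurable (by fun_prop))]
    by_cases htu : t = u
    · subst htu
      rw [pi_integral _ t (fun x : ℝ => x * x)
        (Continuous.aestronglyMeasurable (by fun_prop))]
      simp only [and_self, if_true]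
      simpa [sq] using (gauss_sq v).2
    · simp only [htu, and_false, if_false]
      have hind := (iIndepFun_pi (μ := fun _ : M => gaussianReal 0 v) (X := fun _ x => x)
        (fun _ => aemeasurable_id)).indepFun htu
      rw [hind.integral_fun_mul_eq_mul_integral
        (Continuous.aestronglyMeasurable (by fun_prop))
        (Continuous.aestronglyMeasurable (by fun_prop)), z1, zero_mul]
  · simp only [hij, false_and, if_false]
    have hind := (iIndepFun_pi (μ := fun _ : P => (Measure.pi fun _ : M => gaussianReal 0 v))
      (X := fun _ x => x)
        (fun _ => aemeasurable_id)).indepFun hij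
    have hind2 := hind.comp (φ := fun x : M → ℝ => x t) (ψ := fun x : M → ℝ => x u)
      (show Measurable (fun x : M → ℝ => x t) from measurable_pi_apply t)
      (show Measurable (fun x : M → ℝ => x u) from measurable_pi_apply u)
    have := hind2.integral_fun_mul_eq_mul_integral
        (Continuous.aestronglyMeasurable (by fun_prop))
        (Continuous.aestronglyMeasurable (by fun_prop))
    simp only [Function.comp_def] at this
    rw [this, pi_integral _ i (fun x : M → ℝ => x t)
      (Continuous.aestronglyMeasurable (by fun_prop)), z1, zero_mul]

lemma gm_mgf {P M : Type*} [Fintype P] [Fintype M] (v : NNReal) (i : P) (c : M → ℝ) :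
    Integrable (fun φ : P → M → ℝ => Real.exp (∑ t, c t * φ i t)) (gm P M v) ∧
    ∫ φ : P → M → ℝ, Real.exp (∑ t, c t * φ i t) ∂(gm P M v) =
      Real.exp (v * (∑ t, c t ^ 2) / 2) := by
  unfold gm
  have e : ∀ x : M → ℝ, Real.exp (∑ t, c t * x t) = ∏ t, Real.exp (c t * x t) :=
    fun x => Real.exp_sum _ _
  constructor
  · apply pi_int _ i (fun x : M → ℝ => Real.exp (∑ t, c t * x t))
    simp_rw [e]
    exact Integrable.fintype_prod (f := fun t x => Real.exp (c t * x))
      (fun t => integrable_exp_mul_gaussianReal _)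
  · rw [pi_integral _ i (fun x : M → ℝ => Real.exp (∑ t, c t * x t))
      (Continuous.aestronglyMeasurable (by fun_prop))]
    simp_rw [e]
    rw [integral_fintype_prod_eq_prod (𝕜 := ℝ) (f := fun t x => Real.exp (c t * x))]
    have : ∀ t, ∫ x, Real.exp (c t * x) ∂(gaussianReal 0 v) = Real.exp (v * c t ^ 2 / 2) := by
      intro t
      have := mgf_gaussianReal (p := gaussianReal 0 v) (X := id) (μ := 0) (v := v)
        (by simp) (c t)
      simpa [mgf] using this
    simp_rw [this]
    rw [← Real.exp_sum, Finset.mul_sum, Finset.sum_div]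

/-- the (shift-indexed) probe matrix -/
def PhiM {P : Type*} {n m : ℕ} (h : Fin n → ZMod m) (φ : P → ZMod m → ℝ) :
    Matrix (ZMod m) (P × Fin n) ℝ :=
  Matrix.of fun j ik => φ ik.1 (h ik.2 + j)

lemma PhiM_int {P : Type*} [Fintype P] {n m : ℕ} [NeZero m] (h : Fin n → ZMod m) (v : NNReal)
    (V : Matrix (ZMod m) (ZMod m) ℝ) (a b : P × Fin n) :
    Integrable (fun φ => ((PhiM h φ)ᵀ * V * PhiM h φ) a b) (gm P (ZMod m) v) := by
  have : ∀ φ : P → ZMod m → ℝ, ((PhiM h φ)ᵀ * V * PhiM h φ) a b =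
      ∑ u, ∑ t, V t u * (φ a.1 (h a.2 + t) * φ b.1 (h b.2 + u)) := by
    intro φ
    simp only [Matrix.mul_apply, PhiM, Matrix.transpose_apply, Matrix.of_apply, Finset.sum_mul]
    refine Finset.sum_congr rfl fun u _ => Finset.sum_congr rfl fun t _ => by ring
  simp_rw [this]
  exact integrable_finsetSum _ fun u _ => integrable_finsetSum _ fun t _ =>
    (gm_mul_int v _ _ _ _).const_mul _

lemma PhiM_mean {P : Type*} [Fintype P] [DecidableEq P] {n m : ℕ} [NeZero m] (h : Fin n → ZMod m)
    (hinj : Function.Injective h) (a b : P × Fin n) :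
    ∫ φ, ((PhiM h φ)ᵀ * PhiM h φ) a b ∂(gm P (ZMod m) (m : NNReal)⁻¹) =
      (1 : Matrix (P × Fin n) (P × Fin n) ℝ) a b := by
  have hm : (m:ℝ) ≠ 0 := by exact_mod_cast NeZero.ne m
  simp only [Matrix.mul_apply, PhiM, Matrix.transpose_apply, Matrix.of_apply]
  rw [integral_finsetSum _ fun u _ => gm_mul_int _ _ _ _ _]
  simp_rw [gm_mul]
  simp only [add_left_inj, hinj.eq_iff, ← Prod.ext_iff, Matrix.one_apply]
  split_ifs
  · simp [ZMod.card, hm]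
  · simp

lemma PhiM_cont {P : Type*} {n m : ℕ} [NeZero m] (h : Fin n → ZMod m)  :
    Continuous (fun φ : P → ZMod m → ℝ => PhiM h φ) := by
  unfold PhiM
  refine continuous_matrix fun i j => ?_
  simp only [Matrix.of_apply]
  fun_prop

/-- effect of the swap map on the Gram difference -/
lemma PhiM_swap {P : Type*} {n m : ℕ} [NeZero m] (h : Fin n → ZMod m) (e : ZMod m → ℝ)
    (z : (P → ZMod m → ℝ) × (P → ZMod m → ℝ)) :
    (PhiM h (Wmap (Um e) z).1)ᵀ * PhiM h (Wmap (Um e) z).1 -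
      (PhiM h (Wmap (Um e) z).2)ᵀ * PhiM h (Wmap (Um e) z).2 =
    (PhiM h z.1)ᵀ * Um e * PhiM h z.1 - (PhiM h z.2)ᵀ * Um e * PhiM h z.2 := by
  set U := Um e with hU
  have hs : Uᵀ = U := Um_symm e
  set V := PhiM h z.1
  set V' := PhiM h z.2
  have hc : ∀ (k : Fin n) (j : ZMod m) (x : ZMod m → ℝ),
      ∑ u, U (h k + j) u * x u = ∑ u, U j u * x (h k + u) := by
    intro k j x
    rw [← Equiv.sum_comp (Equiv.addLeft (h k))]
    refine Finset.sum_congr rfl fun u _ => ?_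
    simp only [Equiv.coe_addLeft]
    rw [hU, Um_circ]
  have h1 : PhiM h (Wmap U z).1 = (1/2 : ℝ) • (V + V' + U * (V - V')) := by
    ext j ik
    simp only [PhiM, Wmap, Matrix.of_apply, Matrix.smul_apply, Matrix.add_apply, Matrix.mul_apply,
      Matrix.sub_apply, V, V', smul_eq_mul]
    rw [hc ik.2 j (fun u => z.1 ik.1 u - z.2 ik.1 u)]; ring
  have h2 : PhiM h (Wmap U z).2 = (1/2 : ℝ) • (V + V' - U * (V - V')) := by
    ext j ik
    simp only [PhiM, Wmap, Matrix.of_apply, Matrix.smul_apply, Matrix.add_apply, Matrix.mul_apply,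
      Matrix.sub_apply, V, V', smul_eq_mul]
    rw [hc ik.2 j (fun u => z.1 ik.1 u - z.2 ik.1 u)]; ring
  rw [h1, h2]
  simp only [Matrix.transpose_smul, Matrix.transpose_add, Matrix.transpose_sub,
    Matrix.transpose_mul, hs, Matrix.smul_mul, Matrix.mul_smul, smul_smul,
    Matrix.add_mul, Matrix.mul_add, Matrix.sub_mul, Matrix.mul_sub, ← Matrix.mul_assoc]
  module

lemma sq_le_of_exp {y S c : ℝ} (hy : 0 ≤ y) (hc : 1 ≤ c) (h : Real.exp y ≤ S) :
    y ^ 2 ≤ 2 * Real.log c ^ 2 + 4 * (S / c) := by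
  have hS : 0 < S := lt_of_lt_of_le (Real.exp_pos _) h
  have hcp : 0 < c := by linarith
  have hlc : 0 ≤ Real.log c := Real.log_nonneg hc
  have : 0 < S / c := div_pos hS hcp
  by_cases hyc : y ≤ Real.log c
  · nlinarith
  · push Not at hyc
    set z := y - Real.log c with hz
    have hz0 : 0 ≤ z := by linarith
    have e1 : Real.exp z ≤ S / c := by
      rw [hz, Real.exp_sub, Real.exp_log hcp]
      exact div_le_div_of_nonneg_right h hcp.le
    have e2 := Real.quadratic_le_exp_of_nonneg hz0
    have : y = Real.log c + z := by rw [hz]; ring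
    rw [this]
    nlinarith [sq_nonneg (Real.log c - z)]

/-- uniform bound on the Fourier coefficients of the probe matrix -/
lemma K_bound {P : Type*} [Fintype P] {n m : ℕ} [NeZero m] (h : Fin n → ZMod m) (A : ℝ)
    (hA0 : 1 ≤ A)
    (hA : Real.log (4 * (m * (Fintype.card P * n))) = A) (hpos : 0 < Fintype.card P * n) :
    ∃ K2 : (P → ZMod m → ℝ) → ℝ, (∀ φ, 0 < K2 φ) ∧
      Integrable K2 (gm P (ZMod m) (m : NNReal)⁻¹) ∧
      ∫ φ, K2 φ ∂(gm P (ZMod m) (m : NNReal)⁻¹) ≤ 6 * A / m ∧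
      ∀ φ (l : ZMod m × Bool) (ik : P × Fin n), (∑ t, ub l t * PhiM h φ t ik) ^ 2 ≤ K2 φ := by
  have hm : (0:ℝ) < m := by exact_mod_cast Nat.pos_of_ne_zero (NeZero.ne m)
  have hNp : (0:ℝ) < (Fintype.card P * n) := by exact_mod_cast hpos
  set lam : ℝ := Real.sqrt (2 * m * A) with hlam
  have hlam2 : lam ^ 2 = 2 * m * A := Real.sq_sqrt (by positivity)
  have hlpos : 0 < lam := Real.sqrt_pos.2 (by positivity)
  set c : ℝ := Real.exp (2 * A) with hc
  have hlc : Real.log c = 2 * A := Real.log_exp _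
  have hc1 : 1 ≤ c := Real.one_le_exp (by linarith)
  set g : (ZMod m × Bool) → (P × Fin n) → (P → ZMod m → ℝ) → ℝ :=
    fun l ik φ => ∑ t, ub l t * PhiM h φ t ik with hg
  have hg' : ∀ (r : ℝ) l ik φ, r * g l ik φ = ∑ t, (r * ub l (t - h ik.2)) * φ ik.1 t := by
    intro r l ik φ
    simp only [hg, PhiM, Matrix.of_apply]
    conv_rhs => rw [← Equiv.sum_comp (Equiv.addLeft (h ik.2))]
    rw [Finset.mul_sum]
    refine Finset.sum_congr rfl fun u _ => ?_
    simp; ring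
  have hmgf : ∀ (r : ℝ) l ik, r ^ 2 = lam ^ 2 →
      Integrable (fun φ => Real.exp (r * g l ik φ)) (gm P (ZMod m) (m : NNReal)⁻¹) ∧
      ∫ φ, Real.exp (r * g l ik φ) ∂(gm P (ZMod m) (m : NNReal)⁻¹) ≤ Real.exp A := by
    intro r l ik hr
    simp_rw [hg']
    have := gm_mgf (P := P) (m : NNReal)⁻¹ ik.1 (fun t => r * ub l (t - h ik.2))
    refine ⟨this.1, ?_⟩
    rw [this.2]
    apply Real.exp_le_exp.2
    have e1 : ∑ t, (r * ub l (t - h ik.2)) ^ 2 ≤ lam ^ 2 := by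
      have e2 : ∑ t, (r * ub l (t - h ik.2)) ^ 2 = lam ^ 2 * ∑ t, ub l t ^ 2 := by
        rw [← Equiv.sum_comp (Equiv.addRight (h ik.2)), Finset.mul_sum]
        refine Finset.sum_congr rfl fun u _ => ?_
        simp [mul_pow, hr]
      rw [e2]
      have := ub_sq_sum l
      nlinarith [sq_nonneg lam]
    rw [hlam2] at e1
    have e3 : (((m : NNReal)⁻¹ : NNReal) : ℝ) = (m:ℝ)⁻¹ := by simp
    rw [e3]
    calc (m:ℝ)⁻¹ * (∑ t, (r * ub l (t - h ik.2)) ^ 2) / 2 ≤ (m:ℝ)⁻¹ * (2 * m * A) / 2 := by gcongr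
      _ = A := by field_simp
  set S : (P → ZMod m → ℝ) → ℝ := fun φ => ∑ l, ∑ ik, (Real.exp (lam * g l ik φ) +
    Real.exp (-lam * g l ik φ)) with hS
  have hIntg : ∀ l ik, Integrable (fun φ => Real.exp (lam * g l ik φ) +
      Real.exp (-lam * g l ik φ)) (gm P (ZMod m) (m : NNReal)⁻¹) := fun l ik =>
    (hmgf lam l ik rfl).1.add (hmgf (-lam) l ik (by ring)).1
  have hSint : Integrable S (gm P (ZMod m) (m : NNReal)⁻¹) :=
    integrable_finsetSum _ fun l _ => integrable_finsetSum _ fun ik _ => hIntg l ik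
  have hSpos : ∀ φ, 0 ≤ S φ := fun φ => Finset.sum_nonneg fun l _ =>
    Finset.sum_nonneg fun ik _ => by positivity
  have hSle : ∫ φ, S φ ∂(gm P (ZMod m) (m : NNReal)⁻¹) ≤ c := by
    simp only [hS]
    rw [integral_finsetSum _ fun l _ => integrable_finsetSum _ fun ik _ => hIntg l ik]
    have h1 : ∀ l ∈ (Finset.univ : Finset (ZMod m × Bool)), ∫ φ, ∑ ik, (Real.exp (lam * g l ik φ) +
      Real.exp (-lam * g l ik φ)) ∂(gm P (ZMod m) (m : NNReal)⁻¹) ≤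
        (Fintype.card P * n : ℕ) • (2 * Real.exp A) := by
      intro l _
      rw [integral_finsetSum _ fun ik _ => hIntg l ik]
      have h2 : ∀ ik ∈ (Finset.univ : Finset (P × Fin n)), ∫ φ, (Real.exp (lam * g l ik φ) +
        Real.exp (-lam * g l ik φ)) ∂(gm P (ZMod m) (m : NNReal)⁻¹) ≤ 2 * Real.exp A := by
        intro ik _
        rw [integral_add (hmgf lam l ik rfl).1 (hmgf (-lam) l ik (by ring)).1]
        linarith [(hmgf lam l ik rfl).2, (hmgf (-lam) l ik (by ring)).2]
      refine (Finset.sum_le_card_nsmul _ _ _ h2).trans (le_of_eq ?_)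
      simp
    refine (Finset.sum_le_card_nsmul _ _ _ h1).trans (le_of_eq ?_)
    have : Real.exp A = 4 * (m * (Fintype.card P * n)) := by
      rw [← hA, Real.exp_log (by positivity)]
    rw [hc, two_mul A, Real.exp_add]
    simp only [Finset.card_univ, Fintype.card_prod, ZMod.card, Fintype.card_bool, nsmul_eq_mul]
    nth_rewrite 2 [this]
    push_cast; ring
  refine ⟨fun φ => (2 * Real.log c ^ 2 + 4 * (S φ / c)) / lam ^ 2, ?_, ?_, ?_, ?_⟩
  · intro φ
    have : 0 ≤ S φ / c := div_nonneg (hSpos φ) (by linarith)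
    rw [hlc]
    have : 0 < 2 * (2 * A) ^ 2 := by positivity
    positivity
  · exact ((integrable_const _).add ((hSint.div_const _).const_mul _)).div_const _
  · have h0 : ∫ φ, 4 * (S φ / c) ∂(gm P (ZMod m) (m : NNReal)⁻¹) =
        4 * ((∫ φ, S φ ∂(gm P (ZMod m) (m : NNReal)⁻¹)) / c) := by
      rw [integral_const_mul, integral_div]
    rw [integral_div, integral_add (integrable_const _) ((hSint.div_const _).const_mul _),
      h0, hlc, hlam2]
    simp only [integral_const, probReal_univ, one_smul]
    have h1 : (∫ φ, S φ ∂(gm P (ZMod m) (m : NNReal)⁻¹)) / c ≤ 1 :=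
      (div_le_one (by linarith)).2 hSle
    rw [div_le_div_iff₀ (by positivity) hm]
    have : 2 * (2 * A) ^ 2 + 4 * ((∫ φ, S φ ∂(gm P (ZMod m) (m : NNReal)⁻¹)) / c) ≤ 12 * A ^ 2 := by
      nlinarith
    nlinarith
  · intro φ l ik
    rw [le_div_iff₀ (by positivity)]
    change g l ik φ ^ 2 * lam ^ 2 ≤ _
    have h1 : Real.exp (lam * |g l ik φ|) ≤ S φ := by
      have h2 : Real.exp (lam * |g l ik φ|) ≤ Real.exp (lam * g l ik φ) +
        Real.exp (-lam * g l ik φ) := by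
        rcases abs_cases (g l ik φ) with ⟨h, _⟩ | ⟨h, _⟩
        · rw [h]; linarith [Real.exp_pos (-lam * g l ik φ)]
        · rw [h, mul_neg, ← neg_mul]; linarith [Real.exp_pos (lam * g l ik φ)]
      refine h2.trans ?_
      refine (Finset.single_le_sum (f := fun ik => Real.exp (lam * g l ik φ) +
        Real.exp (-lam * g l ik φ)) (fun _ _ => by positivity) (Finset.mem_univ ik)).trans ?_
      exact Finset.single_le_sum (f := fun l => ∑ ik, (Real.exp (lam * g l ik φ) +
        Real.exp (-lam * g l ik φ))) (fun _ _ => Finset.sum_nonneg fun _ _ => by positivity)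
          (Finset.mem_univ l)
    have := sq_le_of_exp (by positivity) hc1 h1
    rw [mul_pow, sq_abs] at this
    linarith

/-- bilinear form -/
def bq {ι : Type*} [Fintype ι] (A : Matrix ι ι ℝ) (x y : ι → ℝ) : ℝ := ∑ i, ∑ j, x i * A i j * y j

/-- sparse real unit ball -/
def Tset (ι : Type*) [Fintype ι] (s : ℕ) : Set (ι → ℝ) :=
  {x | ∃ Γ : Finset ι, Γ.card ≤ s ∧ (∀ i, i ∉ Γ → x i = 0) ∧ ∑ i, x i ^ 2 ≤ 1}

noncomputable def GG {ι : Type*} [Fintype ι] (s : ℕ) (A : Matrix ι ι ℝ) : ℝ :=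
  sSup ((fun x => |bq A x x|) '' Tset ι s)

section GGsec
variable {ι : Type*} [Fintype ι]

lemma zero_mem_T (s : ℕ) : (0 : ι → ℝ) ∈ Tset ι s := ⟨∅, by simp, by simp, by simp⟩

lemma T_abs {s : ℕ} {x : ι → ℝ} (hx : x ∈ Tset ι s) (i : ι) : |x i| ≤ 1 := by
  obtain ⟨Γ, _, _, h⟩ := hx
  have : x i ^ 2 ≤ 1 := (Finset.single_le_sum (f := fun i => x i ^ 2)
    (fun _ _ => sq_nonneg _) (Finset.mem_univ i)).trans h
  exact (sq_le_one_iff_abs_le_one _).1 this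

lemma T_l1 {s : ℕ} {x : ι → ℝ} (hx : x ∈ Tset ι s) : ∑ i, |x i| ≤ Real.sqrt s := by
  classical
  obtain ⟨Γ, hc, h0, h⟩ := hx
  have e : ∑ i, |x i| = ∑ i ∈ Γ, |x i| := by
    symm
    exact Finset.sum_subset (Finset.subset_univ _) fun i _ hi => by simp [h0 i hi]
  rw [e]
  apply Real.le_sqrt_of_sq_le
  have h1 := sq_sum_le_card_mul_sum_sq (s := Γ) (f := fun i => |x i|)
  have h2 : ∑ i ∈ Γ, |x i| ^ 2 ≤ 1 := by
    simp only [sq_abs]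
    exact (Finset.sum_le_sum_of_subset_of_nonneg (Finset.subset_univ Γ)
      fun _ _ _ => sq_nonneg _).trans h
  have h3 : ((Γ.card : ℕ) : ℝ) ≤ s := by exact_mod_cast hc
  have h4 : (0:ℝ) ≤ (Γ.card : ℕ) := Nat.cast_nonneg _
  nlinarith

lemma bq_le (A : Matrix ι ι ℝ) {s : ℕ} {x y : ι → ℝ} (hx : x ∈ Tset ι s) (hy : y ∈ Tset ι s) :
    |bq A x y| ≤ ∑ i, ∑ j, |A i j| := by
  unfold bq
  refine (Finset.abs_sum_le_sum_abs _ _).trans (Finset.sum_le_sum fun i _ => ?_)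
  refine (Finset.abs_sum_le_sum_abs _ _).trans (Finset.sum_le_sum fun j _ => ?_)
  rw [abs_mul, abs_mul]
  have h1 := T_abs hx i
  have h2 := T_abs hy j
  calc |x i| * |A i j| * |y j| ≤ 1 * |A i j| * 1 := by gcongr
    _ = _ := by ring

lemma GG_bdd (s : ℕ) (A : Matrix ι ι ℝ) : BddAbove ((fun x => |bq A x x|) '' Tset ι s) := by
  refine ⟨∑ i, ∑ j, |A i j|, ?_⟩
  rintro _ ⟨x, hx, rfl⟩
  exact bq_le A hx hx

lemma le_GG (A : Matrix ι ι ℝ) {s : ℕ} {x : ι → ℝ} (hx : x ∈ Tset ι s) : |bq A x x| ≤ GG s A :=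
  le_csSup (GG_bdd s A) ⟨x, hx, rfl⟩

lemma GG_le (A : Matrix ι ι ℝ) {s : ℕ} {b : ℝ} (h : ∀ x ∈ Tset ι s, |bq A x x| ≤ b) :
    GG s A ≤ b := by
  refine csSup_le ⟨_, 0, zero_mem_T s, rfl⟩ ?_
  rintro _ ⟨x, hx, rfl⟩
  exact h x hx

lemma GG_nonneg (s : ℕ) (A : Matrix ι ι ℝ) : 0 ≤ GG s A :=
  (abs_nonneg _).trans (le_GG A (zero_mem_T s))

lemma GG_approx (s : ℕ) (A : Matrix ι ι ℝ) {η : ℝ} (hη : 0 < η) :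
    ∃ x ∈ Tset ι s, GG s A ≤ |bq A x x| + η := by
  obtain ⟨_, ⟨x, hx, rfl⟩, h⟩ := exists_lt_of_lt_csSup (s := (fun x => |bq A x x|) '' Tset ι s)
    ⟨_, 0, zero_mem_T s, rfl⟩ (show GG s A - η < sSup _ by unfold GG; linarith)
  exact ⟨x, hx, by linarith⟩

lemma bq_sub (A B : Matrix ι ι ℝ) (x y : ι → ℝ) : bq (A - B) x y = bq A x y - bq B x y := by
  simp only [bq, Matrix.sub_apply, ← Finset.sum_sub_distrib]
  refine Finset.sum_congr rfl fun i _ => Finset.sum_congr rfl fun j _ => by ring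

lemma GG_sub (s : ℕ) (A B : Matrix ι ι ℝ) : GG s (A - B) ≤ GG s A + GG s B := by
  refine GG_le _ fun x hx => ?_
  rw [bq_sub]
  exact (abs_sub _ _).trans (add_le_add (le_GG A hx) (le_GG B hx))

lemma GG_sum (s : ℕ) (A : Matrix ι ι ℝ) : GG s A ≤ ∑ i, ∑ j, |A i j| :=
  GG_le _ fun _ hx => bq_le A hx hx

lemma GG_lip (s : ℕ) (A B : Matrix ι ι ℝ) : GG s A - GG s B ≤ ∑ i, ∑ j, |A i j - B i j| := by
  have : GG s A ≤ GG s B + ∑ i, ∑ j, |(A - B) i j| := by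
    refine GG_le _ fun x hx => ?_
    have h1 := le_GG B hx
    have h2 := bq_le (A - B) hx hx
    rw [bq_sub] at h2
    have h3 := abs_sub_abs_le_abs_sub (bq A x x) (bq B x x)
    linarith
  simp only [Matrix.sub_apply] at this
  linarith

lemma GG_cont (s : ℕ) : Continuous (fun A : Matrix ι ι ℝ => GG s A) := by
  rw [continuous_iff_continuousAt]
  intro A
  have h : Filter.Tendsto (fun B : Matrix ι ι ℝ => ∑ i, ∑ j, |B i j - A i j|) (nhds A) (nhds 0) := by
    have : Continuous (fun B : Matrix ι ι ℝ => ∑ i, ∑ j, |B i j - A i j|) := by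
      refine continuous_finsetSum _ fun i _ => continuous_finsetSum _ fun j _ => ?_
      exact ((continuous_id.matrix_elem i j).sub continuous_const).abs
    have := this.tendsto A
    simpa using this
  refine tendsto_iff_dist_tendsto_zero.2 (squeeze_zero (fun _ => dist_nonneg) (fun B => ?_) h)
  rw [Real.dist_eq, abs_le]
  have h1 := GG_lip s A B
  have h2 := GG_lip s B A
  have h3 : ∑ i, ∑ j, |A i j - B i j| = ∑ i, ∑ j, |B i j - A i j| := by
    simp only [abs_sub_comm]
  constructor <;> linarith

lemma bq_one [DecidableEq ι] (x : ι → ℝ) : bq (1 : Matrix ι ι ℝ) x x = ∑ i, x i ^ 2 := by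
  simp [bq, Matrix.one_apply, sq]

lemma bq_le_one_add [DecidableEq ι] (A : Matrix ι ι ℝ) {s : ℕ} {x : ι → ℝ} (hx : x ∈ Tset ι s) :
    bq A x x ≤ 1 + GG s (1 - A) := by
  have h1 := le_GG (1 - A) hx
  rw [bq_sub, bq_one] at h1
  obtain ⟨Γ, _, _, h⟩ := hx
  have := (abs_le.1 h1).1
  linarith

lemma bq_polar (A : Matrix ι ι ℝ) (hA : Aᵀ = A) {s : ℕ} (Γ : Finset ι) (hΓ : Γ.card ≤ s)
    (x y : ι → ℝ)
    (hx : ∀ i, i ∉ Γ → x i = 0) (hy : ∀ i, i ∉ Γ → y i = 0) (hx1 : ∑ i, x i ^ 2 ≤ 1)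
    (hy1 : ∑ i, y i ^ 2 ≤ 1) : |bq A x y| ≤ 2 * GG s A := by
  have m : ∀ c : ℝ, c ^ 2 = 1 → (fun i => (x i + c * y i) / 2) ∈ Tset ι s := by
    intro c hc
    refine ⟨Γ, hΓ, fun i hi => by simp [hx i hi, hy i hi], ?_⟩
    calc ∑ i, ((x i + c * y i) / 2) ^ 2 ≤ ∑ i, (x i ^ 2 / 2 + y i ^ 2 / 2) := by
          refine Finset.sum_le_sum fun i _ => ?_
          have : (c * y i) ^ 2 = y i ^ 2 := by rw [mul_pow, hc, one_mul]
          nlinarith [sq_nonneg (x i - c * y i)]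
      _ ≤ 1 := by
          rw [Finset.sum_add_distrib, ← Finset.sum_div, ← Finset.sum_div]; linarith
  have hsym : bq A y x = bq A x y := by
    unfold bq
    rw [Finset.sum_comm]
    refine Finset.sum_congr rfl fun i _ => Finset.sum_congr rfl fun j _ => ?_
    have : A j i = A i j := by rw [← Matrix.transpose_apply A, hA]
    rw [this]; ring
  have key : bq A x y = bq A (fun i => (x i + 1 * y i) / 2) (fun i => (x i + 1 * y i) / 2) -
      bq A (fun i => (x i + (-1) * y i) / 2) (fun i => (x i + (-1) * y i) / 2) := by
    have : bq A x y = (bq A x y + bq A y x) / 2 := by rw [hsym]; ring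
    rw [this]
    simp only [bq, ← Finset.sum_sub_distrib, ← Finset.sum_add_distrib, Finset.sum_div]
    refine Finset.sum_congr rfl fun i _ => Finset.sum_congr rfl fun j _ => by ring
  rw [key]
  refine (abs_sub _ _).trans ?_
  have := le_GG A (m 1 (by norm_num))
  have := le_GG A (m (-1) (by norm_num))
  linarith

lemma snormS_le (s : ℕ) (A : Matrix ι ι ℝ) (hA : Aᵀ = A) :
    snormS s (A.map Complex.ofReal) ≤ 8 * GG s A := by
  unfold snormS
  refine Real.sSup_le ?_ (by have := GG_nonneg s A; linarith)
  rintro r ⟨Γ, x, y, hΓ, hx, hy, hx1, hy1, rfl⟩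
  have e : dotProduct (star y) ((A.map Complex.ofReal).mulVec x) =
      ((bq A (fun i => (y i).re) (fun i => (x i).re) +
        bq A (fun i => (y i).im) (fun i => (x i).im) : ℝ) : ℂ) +
      ((bq A (fun i => (y i).re) (fun i => (x i).im) -
        bq A (fun i => (y i).im) (fun i => (x i).re) : ℝ) : ℂ) * Complex.I := by
    simp only [dotProduct, Matrix.mulVec, bq, Finset.mul_sum, Pi.star_apply, Matrix.map_apply,
      ← Finset.sum_add_distrib, ← Finset.sum_sub_distrib]
    push_cast
    rw [Finset.sum_mul, ← Finset.sum_add_distrib]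
    refine Finset.sum_congr rfl fun i _ => ?_
    rw [Finset.sum_mul, ← Finset.sum_add_distrib]
    refine Finset.sum_congr rfl fun j _ => ?_
    apply Complex.ext <;> simp <;> ring
  have n1 : ∀ z : ι → ℂ, ∑ i, ‖z i‖ ^ 2 = 1 → ∑ i, (z i).re ^ 2 ≤ 1 ∧ ∑ i, (z i).im ^ 2 ≤ 1 := by
    intro z hz
    rw [← hz]
    constructor <;> refine Finset.sum_le_sum fun i _ => ?_ <;>
      rw [Complex.sq_norm, Complex.normSq_apply] <;> nlinarith [sq_nonneg (z i).re, sq_nonneg (z i).im]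
  obtain ⟨x1, x2⟩ := n1 x hx1
  obtain ⟨y1, y2⟩ := n1 y hy1
  have hxr : ∀ i, i ∉ Γ → (x i).re = 0 := fun i hi => by simp [hx i hi]
  have hxi : ∀ i, i ∉ Γ → (x i).im = 0 := fun i hi => by simp [hx i hi]
  have hyr : ∀ i, i ∉ Γ → (y i).re = 0 := fun i hi => by simp [hy i hi]
  have hyi : ∀ i, i ∉ Γ → (y i).im = 0 := fun i hi => by simp [hy i hi]
  have b1 := bq_polar A hA Γ hΓ _ _ hyr hxr y1 x1
  have b2 := bq_polar A hA Γ hΓ _ _ hyi hxi y2 x2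
  have b3 := bq_polar A hA Γ hΓ _ _ hyr hxi y1 x2
  have b4 := bq_polar A hA Γ hΓ _ _ hyi hxr y2 x1
  rw [e]
  refine (norm_add_le _ _).trans ?_
  rw [norm_mul, Complex.norm_I, mul_one, Complex.norm_real, Complex.norm_real, Real.norm_eq_abs,
    Real.norm_eq_abs]
  refine (add_le_add (abs_add_le _ _) (abs_sub _ _)).trans ?_
  linarith

lemma snormS_nonneg (s : ℕ) (A : Matrix ι ι ℂ) : 0 ≤ snormS s A := by
  refine Real.sSup_nonneg ?_
  rintro r ⟨Γ, x, y, -, -, -, -, -, rfl⟩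
  exact norm_nonneg _

end GGsec

noncomputable def eS {m : ℕ} (ε : ZMod m → Bool) (w : ZMod m) : ℝ := sg (ε (rr w))

lemma sg_sq (b : Bool) : sg b * sg b = 1 := by cases b <;> simp [sg]

lemma bq_gram {m : ℕ} [NeZero m] {ι : Type*} [Fintype ι] (B : Matrix (ZMod m) ι ℝ)
    (e : ZMod m → ℝ) (x : ι → ℝ) :
    bq (Bᵀ * Um e * B) x x =
      ∑ l : ZMod m × Bool, e l.1 * (∑ i, (∑ t, ub l t * B t i) * x i) ^ 2 := by
  have h1 : ∀ l : ZMod m × Bool, ∑ i, (∑ t, ub l t * B t i) * x i =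
      ∑ t, ub l t * (∑ i, B t i * x i) := by
    intro l
    simp only [Finset.sum_mul, Finset.mul_sum]
    rw [Finset.sum_comm]
    refine Finset.sum_congr rfl fun i _ => Finset.sum_congr rfl fun j _ => by ring
  simp_rw [h1]
  rw [← Um_quad]
  have h2 : ∀ (V : Matrix ι ι ℝ), bq V x x = x ⬝ᵥ (V *ᵥ x) := by
    intro V
    simp only [bq, dotProduct, Matrix.mulVec, Finset.mul_sum]
    refine Finset.sum_congr rfl fun i _ => Finset.sum_congr rfl fun j _ => by ring
  have h3 : ∑ t, ∑ u, (∑ i, B t i * x i) * Um e t u * (∑ i, B u i * x i) =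
      (B *ᵥ x) ⬝ᵥ (Um e *ᵥ (B *ᵥ x)) := by
    simp only [dotProduct, Matrix.mulVec, Finset.mul_sum]
    refine Finset.sum_congr rfl fun i _ => Finset.sum_congr rfl fun j _ => ?_
    refine Finset.sum_congr rfl fun k _ => by ring
  rw [h2, h3, ← Matrix.mulVec_mulVec, ← Matrix.mulVec_mulVec, Matrix.dotProduct_mulVec,
    Matrix.vecMul_transpose]

noncomputable def Dc (s m N k0 : ℕ) : ℝ :=
  ((k0 : ℝ) + 2) * (12 * (2 * Real.sqrt s * Real.sqrt (2 * Real.log (2 * (m * 2)))) *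
    Real.sqrt (12 * Real.log (2 * N)))

lemma chain_app {m : ℕ} [NeZero m] {ι : Type*} [Fintype ι] [DecidableEq ι] [Nonempty ι]
    (B : Matrix (ZMod m) ι ℝ)
    (s : ℕ) (hs : 0 < s) (K : ℝ) (hK : 0 < K) (ha : ∀ l i, |∑ t, ub l t * B t i| ≤ K)
    (k0 : ℕ) (hk0 : m * 2 ≤ 2 ^ k0) :
    ∑ ε : ZMod m → Bool, GG s (Bᵀ * Um (eS ε) * B) ≤
      2 ^ m * (Dc s m (Fintype.card ι) k0 * K * Real.sqrt (1 + GG s (1 - Bᵀ * B))) := by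
  have hG := GG_nonneg s (1 - Bᵀ * B)
  refine le_of_forall_pos_le_add fun η hη => ?_
  have hη' : 0 < η / 2 ^ m := by positivity
  choose X hX hXG using fun ε : ZMod m → Bool => GG_approx s (Bᵀ * Um (eS ε) * B) hη'
  have hc := chain (ι := ι) (Λ := ZMod m × Bool) (J := ZMod m)
    (fun l i => ∑ t, ub l t * B t i) (fun l => rr l.1) rr_fib K (Real.sqrt s)
    (Real.sqrt (1 + GG s (1 - Bᵀ * B))) hK (Real.sqrt_pos.2 (by exact_mod_cast hs))
    (Real.sqrt_pos.2 (by linarith)) ha (Tset ι s) (fun x hx => T_l1 hx)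
    (fun x hx => by
      rw [Real.sq_sqrt (by linarith)]
      have h1 := bq_gram B (fun _ => 1) x
      simp only [one_mul] at h1
      rw [← h1, Um_one, Matrix.mul_one]
      exact bq_le_one_add _ hx) X hX k0 (by simpa [ZMod.card] using hk0)
  calc ∑ ε : ZMod m → Bool, GG s (Bᵀ * Um (eS ε) * B)
      ≤ ∑ ε : ZMod m → Bool, (|bq (Bᵀ * Um (eS ε) * B) (X ε) (X ε)| + η / 2 ^ m) :=
        Finset.sum_le_sum fun ε _ => hXG ε
    _ = ∑ ε : ZMod m → Bool, |bq (Bᵀ * Um (eS ε) * B) (X ε) (X ε)| + η := by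
        rw [Finset.sum_add_distrib]
        have h2m : (2:ℝ) ^ m ≠ 0 := by positivity
        simp [ZMod.card]
        field_simp
    _ ≤ _ := by
        refine add_le_add ?_ le_rfl
        simp_rw [bq_gram]
        refine hc.trans (le_of_eq ?_)
        simp only [Dc, Fintype.card_prod, ZMod.card, Fintype.card_bool]
        push_cast
        ring

lemma GG_integrable {Ω : Type*} [TopologicalSpace Ω] [MeasurableSpace Ω] [OpensMeasurableSpace Ω]
    [SecondCountableTopology Ω]
    {ι : Type*} [Fintype ι] (μ : Measure Ω) (s : ℕ) (F : Ω → Matrix ι ι ℝ) (hF : Continuous F)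
    (hi : ∀ i j, Integrable (fun ω => F ω i j) μ) : Integrable (fun ω => GG s (F ω)) μ := by
  refine (integrable_finsetSum Finset.univ fun i _ => integrable_finsetSum Finset.univ
    fun j _ => (hi i j).abs).mono' ((GG_cont s).comp hF).aestronglyMeasurable
    (Filter.Eventually.of_forall fun ω => ?_)
  rw [Real.norm_eq_abs, abs_of_nonneg (GG_nonneg _ _)]
  exact GG_sum s (F ω)

section mainsec
variable {P : Type*} [Fintype P] [DecidableEq P] {n m : ℕ} [NeZero m]

lemma gram_cont (h : Fin n → ZMod m) (V : Matrix (ZMod m) (ZMod m) ℝ) :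
    Continuous (fun φ : P → ZMod m → ℝ => (PhiM h φ)ᵀ * V * PhiM h φ) :=
  (((PhiM_cont h).matrix_transpose).matrix_mul continuous_const).matrix_mul (PhiM_cont h)

lemma jensen (h : Fin n → ZMod m) (hinj : Function.Injective h) (s : ℕ)
    (φ : P → ZMod m → ℝ) :
    GG s (1 - (PhiM h φ)ᵀ * PhiM h φ) ≤
      ∫ ψ, GG s ((PhiM h φ)ᵀ * PhiM h φ - (PhiM h ψ)ᵀ * PhiM h ψ)
        ∂(gm P (ZMod m) (m : NNReal)⁻¹) := by
  have hent : ∀ a b, Integrable (fun ψ => ((PhiM h ψ)ᵀ * PhiM h ψ) a b)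
      (gm P (ZMod m) (m : NNReal)⁻¹) := by
    intro a b
    have := PhiM_int (P := P) h (m : NNReal)⁻¹ 1 a b
    simpa only [Matrix.mul_one] using this
  have hcont : Continuous (fun ψ : P → ZMod m → ℝ => (PhiM h ψ)ᵀ * PhiM h ψ) := by
    simpa only [Matrix.mul_one] using gram_cont (P := P) h 1
  have hIntg : Integrable (fun ψ => GG s ((PhiM h φ)ᵀ * PhiM h φ - (PhiM h ψ)ᵀ * PhiM h ψ))
      (gm P (ZMod m) (m : NNReal)⁻¹) := by
    refine GG_integrable _ s _ (continuous_const.sub hcont) fun a b => ?_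
    simp only [Matrix.sub_apply]
    exact (integrable_const _).sub (hent a b)
  refine GG_le _ fun x hx => ?_
  have hbq : ∫ ψ, bq ((PhiM h ψ)ᵀ * PhiM h ψ) x x ∂(gm P (ZMod m) (m : NNReal)⁻¹) = bq 1 x x := by
    unfold bq
    rw [integral_finsetSum _ fun i _ => integrable_finsetSum _ fun j _ =>
      ((hent i j).const_mul _).mul_const _]
    refine Finset.sum_congr rfl fun i _ => ?_
    rw [integral_finsetSum _ fun j _ => ((hent i j).const_mul _).mul_const _]
    refine Finset.sum_congr rfl fun j _ => ?_
    rw [integral_mul_const, integral_const_mul, PhiM_mean h hinj]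
  have hbqi : Integrable (fun ψ => bq ((PhiM h ψ)ᵀ * PhiM h ψ) x x)
      (gm P (ZMod m) (m : NNReal)⁻¹) := by
    unfold bq
    exact integrable_finsetSum _ fun i _ => integrable_finsetSum _ fun j _ =>
      ((hent i j).const_mul _).mul_const _
  have e1 : ∫ ψ, bq ((PhiM h φ)ᵀ * PhiM h φ - (PhiM h ψ)ᵀ * PhiM h ψ) x x
      ∂(gm P (ZMod m) (m : NNReal)⁻¹) = - bq (1 - (PhiM h φ)ᵀ * PhiM h φ) x x := by
    simp_rw [bq_sub]
    rw [integral_sub (integrable_const _) hbqi, hbq]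
    simp
  rw [← abs_neg, ← e1]
  refine (abs_integral_le_integral_abs).trans ?_
  refine integral_mono_of_nonneg (Filter.Eventually.of_forall fun _ => abs_nonneg _) hIntg
    (Filter.Eventually.of_forall fun ψ => le_GG _ hx)

lemma E_le (h : Fin n → ZMod m) (hinj : Function.Injective h) (s : ℕ) (e : ZMod m → ℝ)
    (he : ∀ w, e (-w) = e w) (he2 : ∀ w, e w * e w = 1) :
    ∫ φ, GG s (1 - (PhiM h φ)ᵀ * PhiM h φ) ∂(gm P (ZMod m) (m : NNReal)⁻¹) ≤
      2 * ∫ φ, GG s ((PhiM h φ)ᵀ * Um e * PhiM h φ) ∂(gm P (ZMod m) (m : NNReal)⁻¹) := by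
  set μ := gm P (ZMod m) (m : NNReal)⁻¹ with hμ
  have hent : ∀ (V : Matrix (ZMod m) (ZMod m) ℝ) a b, Integrable (fun ψ => ((PhiM h ψ)ᵀ * V * PhiM h ψ) a b) μ :=
    fun V a b => PhiM_int h _ V a b
  have hent1 : ∀ a b, Integrable (fun ψ => ((PhiM h ψ)ᵀ * PhiM h ψ) a b) μ := by
    intro a b
    simpa only [Matrix.mul_one] using hent 1 a b
  have hcont : Continuous (fun ψ : P → ZMod m → ℝ => (PhiM h ψ)ᵀ * PhiM h ψ) := by
    simpa only [Matrix.mul_one] using gram_cont (P := P) h 1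
  set F : ((P → ZMod m → ℝ) × (P → ZMod m → ℝ)) → ℝ := fun z =>
    GG s ((PhiM h z.1)ᵀ * PhiM h z.1 - (PhiM h z.2)ᵀ * PhiM h z.2) with hFdef
  have hFc : Continuous F :=
    (GG_cont s).comp ((hcont.comp continuous_fst).sub (hcont.comp continuous_snd))
  have hF : Integrable F (μ.prod μ) := by
    refine GG_integrable _ s _ ((hcont.comp continuous_fst).sub (hcont.comp continuous_snd))
      fun a b => ?_
    exact ((hent1 a b).comp_fst μ).sub ((hent1 a b).comp_snd μ)
  have h1 : Integrable (fun φ => GG s (1 - (PhiM h φ)ᵀ * PhiM h φ)) μ := by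
    refine GG_integrable _ s _ (continuous_const.sub hcont) fun a b => ?_
    exact (integrable_const _).sub (hent1 a b)
  have hV : Integrable (fun φ => GG s ((PhiM h φ)ᵀ * Um e * PhiM h φ)) μ :=
    GG_integrable _ s _ (gram_cont h _) fun a b => hent _ a b
  have s1 : ∫ φ, GG s (1 - (PhiM h φ)ᵀ * PhiM h φ) ∂μ ≤ ∫ z, F z ∂(μ.prod μ) := by
    rw [integral_prod _ hF]
    exact integral_mono h1 hF.integral_prod_left fun φ => jensen h hinj s φ
  have s2 : ∫ z, F z ∂(μ.prod μ) = ∫ z, F (Wmap (Um e) z) ∂(μ.prod μ) := by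
    have hi := gm_invariant (P := P) (m : NNReal)⁻¹ (Um e) (Um_symm e) (Um_sq e he he2)
    rw [← hμ] at hi
    conv_lhs => rw [← hi]
    rw [integral_map (Wmap_cont _).measurable.aemeasurable hFc.aestronglyMeasurable]
  rw [s2] at s1
  refine s1.trans ?_
  have s3 : ∫ z, F (Wmap (Um e) z) ∂(μ.prod μ) ≤
      ∫ z : (P → ZMod m → ℝ) × (P → ZMod m → ℝ),
        (GG s ((PhiM h z.1)ᵀ * Um e * PhiM h z.1) + GG s ((PhiM h z.2)ᵀ * Um e * PhiM h z.2))
        ∂(μ.prod μ) := by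
    refine integral_mono_of_nonneg (Filter.Eventually.of_forall fun _ => GG_nonneg _ _)
      ((hV.comp_fst μ).add (hV.comp_snd μ)) (Filter.Eventually.of_forall fun z => ?_)
    simp only [hFdef]
    rw [PhiM_swap]
    exact GG_sub s _ _
  refine s3.trans (le_of_eq ?_)
  rw [integral_add (hV.comp_fst μ) (hV.comp_snd μ),
    integral_fun_fst (fun φ => GG s ((PhiM h φ)ᵀ * Um e * PhiM h φ)),
    integral_fun_snd (fun φ => GG s ((PhiM h φ)ᵀ * Um e * PhiM h φ))]
  simp only [probReal_univ, one_smul]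
  ring

lemma E_main (h : Fin n → ZMod m) (hinj : Function.Injective h) (s : ℕ) (hs : 0 < s) (A τ : ℝ)
    (hA0 : 1 ≤ A) (hA : Real.log (4 * (m * (Fintype.card P * n))) = A)
    (hpos : 0 < Fintype.card P * n) (hτ : 0 < τ) (k0 : ℕ) (hk0 : m * 2 ≤ 2 ^ k0) :
    ∫ φ, GG s (1 - (PhiM h φ)ᵀ * PhiM h φ) ∂(gm P (ZMod m) (m : NNReal)⁻¹) ≤
      2 * (Dc s m (Fintype.card P * n) k0 ^ 2 / τ * (6 * A / m) + τ / 4 * (1 +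
        ∫ φ, GG s (1 - (PhiM h φ)ᵀ * PhiM h φ) ∂(gm P (ZMod m) (m : NNReal)⁻¹))) := by
  obtain ⟨K2, hK0, hKi, hKle, hK⟩ := K_bound (P := P) h A hA0 hA hpos
  set μ := gm P (ZMod m) (m : NNReal)⁻¹ with hμ
  set D := Dc s m (Fintype.card P * n) k0 with hD
  have hne : Nonempty (P × Fin n) := by
    rw [← Fintype.card_pos_iff]; simpa using hpos
  have hent1 : ∀ a b, Integrable (fun ψ => ((PhiM h ψ)ᵀ * PhiM h ψ) a b) μ := by
    intro a b
    simpa only [Matrix.mul_one] using PhiM_int h (m : NNReal)⁻¹ 1 a b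
  have hcont : Continuous (fun ψ : P → ZMod m → ℝ => (PhiM h ψ)ᵀ * PhiM h ψ) := by
    simpa only [Matrix.mul_one] using gram_cont (P := P) h 1
  have h1 : Integrable (fun φ => GG s (1 - (PhiM h φ)ᵀ * PhiM h φ)) μ := by
    refine GG_integrable _ s _ (continuous_const.sub hcont) fun a b => ?_
    exact (integrable_const _).sub (hent1 a b)
  have hV : ∀ e : ZMod m → ℝ, Integrable (fun φ => GG s ((PhiM h φ)ᵀ * Um e * PhiM h φ)) μ := fun e =>
    GG_integrable _ s _ (gram_cont h _) fun a b => PhiM_int h _ _ a b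
  set E := ∫ φ, GG s (1 - (PhiM h φ)ᵀ * PhiM h φ) ∂μ with hE
  have hp : ∀ φ, ∑ ε : ZMod m → Bool, GG s ((PhiM h φ)ᵀ * Um (eS ε) * PhiM h φ) ≤
      2 ^ m * (D ^ 2 / τ * K2 φ + τ / 4 * (1 + GG s (1 - (PhiM h φ)ᵀ * PhiM h φ))) := by
    intro φ
    have hG := GG_nonneg s (1 - (PhiM h φ)ᵀ * PhiM h φ)
    have := chain_app (PhiM h φ) s hs (Real.sqrt (K2 φ)) (Real.sqrt_pos.2 (hK0 φ))
      (fun l i => Real.abs_le_sqrt (hK φ l i)) k0 hk0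
    refine this.trans ?_
    gcongr
    rw [Fintype.card_prod, Fintype.card_fin, ← hD]
    have q1 := Real.sq_sqrt (hK0 φ).le
    have q2 := Real.sq_sqrt (show 0 ≤ 1 + GG s (1 - (PhiM h φ)ᵀ * PhiM h φ) by linarith)
    set k := Real.sqrt (K2 φ)
    set R := Real.sqrt (1 + GG s (1 - (PhiM h φ)ᵀ * PhiM h φ))
    rw [← q1, ← q2]
    have e : D ^ 2 / τ * k ^ 2 + τ / 4 * R ^ 2 - D * k * R = (D * k - τ / 2 * R) ^ 2 / τ := by
      field_simp; ring
    have : 0 ≤ (D * k - τ / 2 * R) ^ 2 / τ := by positivity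
    linarith
  have hsum : (2:ℝ) ^ m * E ≤ 2 * ∫ φ, ∑ ε : ZMod m → Bool,
      GG s ((PhiM h φ)ᵀ * Um (eS ε) * PhiM h φ) ∂μ := by
    rw [integral_finsetSum _ fun ε _ => hV (eS ε), Finset.mul_sum]
    have hc : ∑ ε : ZMod m → Bool, E = (2:ℝ) ^ m * E := by simp [ZMod.card]
    rw [← hc]
    refine Finset.sum_le_sum fun ε _ => ?_
    exact E_le h hinj s (eS ε) (fun w => by simp only [eS, rr_neg]) (fun w => sg_sq _)
  have hi2 : ∫ φ, ∑ ε : ZMod m → Bool, GG s ((PhiM h φ)ᵀ * Um (eS ε) * PhiM h φ) ∂μ ≤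
      ∫ φ, 2 ^ m * (D ^ 2 / τ * K2 φ + τ / 4 * (1 + GG s (1 - (PhiM h φ)ᵀ * PhiM h φ))) ∂μ := by
    refine integral_mono (integrable_finsetSum _ fun ε _ => hV (eS ε)) ?_ hp
    exact ((hKi.const_mul _).add (((integrable_const _).add h1).const_mul _)).const_mul _
  have hi3 : ∫ φ, 2 ^ m * (D ^ 2 / τ * K2 φ + τ / 4 * (1 + GG s (1 - (PhiM h φ)ᵀ * PhiM h φ))) ∂μ
      = 2 ^ m * (D ^ 2 / τ * (∫ φ, K2 φ ∂μ) + τ / 4 * (1 + E)) := by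
    rw [integral_const_mul]
    congr 1
    have h1' : Integrable (fun φ => 1 + GG s (1 - (PhiM h φ)ᵀ * PhiM h φ)) μ :=
      (integrable_const _).add h1
    rw [integral_add (hKi.const_mul _) (h1'.const_mul _)]
    congr 1
    · rw [integral_const_mul]
    · rw [integral_const_mul]
      congr 1
      rw [integral_add (integrable_const _) h1]
      simp [hE]
  rw [hi3] at hi2
  have h2m : (0:ℝ) < 2 ^ m := by positivity
  have hDt : 0 ≤ D ^ 2 / τ := by positivity
  have hfin : (2:ℝ) ^ m * E ≤ 2 ^ m * (2 * (D ^ 2 / τ * (6 * A / m) + τ / 4 * (1 + E))) := by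
    have : D ^ 2 / τ * (∫ φ, K2 φ ∂μ) ≤ D ^ 2 / τ * (6 * A / m) :=
      mul_le_mul_of_nonneg_left hKle hDt
    have h3 : 2 ^ m * (D ^ 2 / τ * (∫ φ, K2 φ ∂μ) + τ / 4 * (1 + E)) ≤
      2 ^ m * (D ^ 2 / τ * (6 * A / m) + τ / 4 * (1 + E)) := by gcongr
    linarith
  exact le_of_mul_le_mul_left hfin h2m

end mainsec

lemma Dc_bound (s m N : ℕ) (hm : 1 ≤ m) (hmN : m ≤ N) (hN : 2 ≤ N) :
    ∃ k0 : ℕ, m * 2 ≤ 2 ^ k0 ∧ Dc s m N k0 ^ 2 ≤ 64 * 144 * 4 * 6 * 24 * s * Real.log N ^ 4 := by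
  set L := Real.log N with hL
  have hN' : (2:ℝ) ≤ N := by exact_mod_cast hN
  have hm' : (1:ℝ) ≤ m := by exact_mod_cast hm
  have hmN' : (m:ℝ) ≤ N := by exact_mod_cast hmN
  have hl2 : Real.log 2 ≤ L := Real.log_le_log (by norm_num) hN'
  have hl2' : 0.69 < Real.log 2 := by linarith [Real.log_two_gt_d9]
  have hmL : Real.log m ≤ L := Real.log_le_log (by linarith) hmN'
  refine ⟨Nat.clog 2 (m * 2), Nat.le_pow_clog (by norm_num) _, ?_⟩
  set k0 := Nat.clog 2 (m * 2) with hk0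
  have hk : (k0 : ℝ) + 2 ≤ 8 * L := by
    have h1 : 2 ^ (k0 - 1) < m * 2 := Nat.pow_pred_clog_lt_self (by norm_num) (by omega)
    have hk1 : 1 ≤ k0 := Nat.clog_pos (by norm_num) (by omega)
    have h2 : (2:ℝ) ^ (k0 - 1) < m * 2 := by exact_mod_cast h1
    have h3 := Real.log_lt_log (by positivity) h2
    rw [Real.log_pow, Real.log_mul (by linarith) (by norm_num), Nat.cast_sub hk1] at h3
    push_cast at h3
    nlinarith
  have h4m : Real.log (2 * (m * 2)) ≤ 3 * L := by
    rw [Real.log_mul (by norm_num) (by positivity), Real.log_mul (by linarith) (by norm_num)]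
    linarith
  have h4m0 : 0 ≤ Real.log (2 * (m * 2)) := Real.log_nonneg (by linarith)
  have h2N : Real.log (2 * N) ≤ 2 * L := by
    rw [Real.log_mul (by norm_num) (by linarith)]
    linarith
  have h2N0 : 0 ≤ Real.log (2 * N) := Real.log_nonneg (by linarith)
  have e : Dc s m N k0 ^ 2 = ((k0:ℝ) + 2) ^ 2 * (144 * 4 * s * (2 * Real.log (2 * (m * 2))) *
      (12 * Real.log (2 * N))) := by
    unfold Dc
    simp only [mul_pow]
    rw [Real.sq_sqrt (by positivity), Real.sq_sqrt (by positivity), Real.sq_sqrt (by positivity)]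
    ring
  rw [e]
  calc ((k0:ℝ) + 2) ^ 2 * (144 * 4 * s * (2 * Real.log (2 * (m * 2))) * (12 * Real.log (2 * N)))
      ≤ (8 * L) ^ 2 * (144 * 4 * s * (2 * (3 * L)) * (12 * (2 * L))) := by gcongr
    _ = _ := by ring

lemma main_G {P : Type*} [Fintype P] [DecidableEq P] {n m : ℕ} [NeZero m]
    (h : Fin n → ZMod m) (hinj : Function.Injective h) (s : ℕ) (hs : 0 < s) (δ : ℝ)
    (hδ : 0 < δ) (hδ1 : δ ≤ 1) (hmN : m ≤ Fintype.card P * n) (hN : 2 ≤ Fintype.card P * n)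
    (hC : 10 ^ 11 * δ⁻¹ ^ 2 * s * Real.log ((Fintype.card P * n : ℕ) : ℝ) ^ 5 ≤ m) :
    ∫ φ, GG s (1 - (PhiM h φ)ᵀ * PhiM h φ) ∂(gm P (ZMod m) (m : NNReal)⁻¹) ≤ δ / 8 := by
  have hm : 1 ≤ m := Nat.pos_of_ne_zero (NeZero.ne m)
  obtain ⟨k0, hk0, hD⟩ := Dc_bound s m (Fintype.card P * n) hm hmN hN
  have hN' : (2:ℝ) ≤ ((Fintype.card P * n : ℕ) : ℝ) := by exact_mod_cast hN
  have hm' : (1:ℝ) ≤ m := by exact_mod_cast hm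
  have hmN' : (m:ℝ) ≤ ((Fintype.card P * n : ℕ) : ℝ) := by exact_mod_cast hmN
  have hcast : ((Fintype.card P : ℝ) * n) = ((Fintype.card P * n : ℕ) : ℝ) := by push_cast; rfl
  set A := Real.log (4 * (m * ((Fintype.card P : ℝ) * n))) with hA
  set N := Fintype.card P * n with hNdef
  set L := Real.log (N : ℝ) with hL
  have hl2 : Real.log 2 ≤ L := Real.log_le_log (by norm_num) hN'
  have hl2' : 0.69 < Real.log 2 := by linarith [Real.log_two_gt_d9]
  have hmL : Real.log m ≤ L := Real.log_le_log (by linarith) hmN'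
  have hm0 : 0 ≤ Real.log m := Real.log_nonneg hm'
  have hA' : A = 2 * Real.log 2 + (Real.log m + L) := by
    rw [hA, hcast, Real.log_mul (by norm_num) (by positivity),
      Real.log_mul (by linarith) (by linarith)]
    congr 1
    rw [show (4:ℝ) = 2 ^ 2 by norm_num, Real.log_pow]; norm_num
  have hA1 : 1 ≤ A := by linarith
  have hA4 : A ≤ 4 * L := by linarith
  have key := E_main (P := P) h hinj s hs A (δ / 16) hA1 hA.symm (by omega) (by positivity) k0 hk0
  set E := ∫ φ, GG s (1 - (PhiM h φ)ᵀ * PhiM h φ) ∂(gm P (ZMod m) (m : NNReal)⁻¹) with hE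
  have hE0 : 0 ≤ E := integral_nonneg fun _ => GG_nonneg _ _
  set D2 := Dc s m N k0 ^ 2 with hD2
  have hLpos : 0 < L := by linarith
  have h1 : D2 * A ≤ 64 * 144 * 4 * 6 * 24 * s * L ^ 4 * (4 * L) := by
    have : 0 ≤ D2 := sq_nonneg _
    gcongr
  have h2 : 3072 * (D2 * A) ≤ δ ^ 2 * m := by
    have h3 : δ ^ 2 * (10 ^ 11 * δ⁻¹ ^ 2 * s * L ^ 5) ≤ δ ^ 2 * m := by gcongr
    have h4 : δ ^ 2 * (10 ^ 11 * δ⁻¹ ^ 2 * s * L ^ 5) = 10 ^ 11 * (s * L ^ 5) := by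
      field_simp
    have h5 : 0 ≤ s * L ^ 5 := by positivity
    rw [h4] at h3
    nlinarith
  have h3 : D2 / (δ / 16) * (6 * A / m) ≤ δ / 32 := by
    have : D2 / (δ / 16) * (6 * A / m) = 96 * (D2 * A) / (δ * m) := by
      field_simp; ring
    rw [this, div_le_iff₀ (by positivity)]
    nlinarith
  nlinarith

lemma probe_eq (p n m' : ℕ) (φ : Fin p → Fin (m' + 1) → ℝ) :
    probeMatrix p n (m' + 1) φ =
      PhiM (P := Fin p) (n := n) (m := m' + 1)
        (fun k => (⟨(n - 1 - (k : ℕ)) % (m' + 1), Nat.mod_lt _ (Nat.succ_pos _)⟩ : Fin (m' + 1)))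
        φ := by
  ext j ik
  simp only [probeMatrix, PhiM, Matrix.of_apply]
  congr 1
  apply Fin.ext
  change _ = (((⟨(n - 1 - (ik.2 : ℕ)) % (m' + 1), Nat.mod_lt _ (Nat.succ_pos _)⟩ : Fin (m' + 1)) +
    (j : Fin (m' + 1)) : Fin (m' + 1)) : ℕ)
  rw [Fin.val_add]
  simp

theorem stmt1 : ∃ C7 : ℝ, 0 < C7 ∧
    ∀ (p n m s : ℕ) (δ : ℝ), 1 ≤ p → 2 ≤ n → n ≤ m → m ≤ n * p → 2 ≤ s → s ≤ n * p →
    0 < δ → δ ≤ 1 →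
    C7 * δ⁻¹ ^ 2 * s * (Real.log ((n : ℝ) * p)) ^ 5 ≤ m →
    (∫ φ, snormS s ((1 - (probeMatrix p n m φ)ᵀ * probeMatrix p n m φ).map Complex.ofReal)
        ∂(gaussMeasure p m)) ≤ δ := by
  refine ⟨10 ^ 11, by norm_num, ?_⟩
  intro p n m s δ hp hn hnm hmN hs _ hδ hδ1 hC
  obtain ⟨m', rfl⟩ : ∃ m', m = m' + 1 := ⟨m - 1, by omega⟩
  set h : Fin n → ZMod (m' + 1) :=
    fun k => (⟨(n - 1 - (k : ℕ)) % (m' + 1), Nat.mod_lt _ (Nat.succ_pos _)⟩ : Fin (m' + 1)) with hh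
  have hinj : Function.Injective h := by
    intro a b hab
    have h1 : (n - 1 - (a : ℕ)) % (m' + 1) = (n - 1 - (b : ℕ)) % (m' + 1) :=
      congrArg Fin.val (show (⟨(n - 1 - (a : ℕ)) % (m' + 1), _⟩ : Fin (m' + 1)) =
        ⟨(n - 1 - (b : ℕ)) % (m' + 1), _⟩ from hab)
    have ha := a.2
    have hb := b.2
    rw [Nat.mod_eq_of_lt (by omega), Nat.mod_eq_of_lt (by omega)] at h1
    apply Fin.ext
    omega
  have hcomm : n * p = p * n := Nat.mul_comm _ _
  have hN2 : 2 ≤ p * n := by nlinarith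
  have hlog : Real.log ((n : ℝ) * p) = Real.log ((Fintype.card (Fin p) * n : ℕ) : ℝ) := by
    rw [Fintype.card_fin, ← hcomm]; push_cast; rfl
  rw [hlog] at hC
  have hG := main_G (P := Fin p) h hinj s (by omega) δ hδ hδ1
    (by rw [Fintype.card_fin]; omega) (by rw [Fintype.card_fin]; omega) hC
  have hent1 : ∀ a b, Integrable (fun ψ => ((PhiM h ψ)ᵀ * PhiM h ψ) a b)
      (gm (Fin p) (ZMod (m' + 1)) ((m' + 1 : ℕ) : NNReal)⁻¹) := by
    intro a b
    simpa only [Matrix.mul_one] using PhiM_int h ((m' + 1 : ℕ) : NNReal)⁻¹ 1 a b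
  have hcont : Continuous (fun ψ : Fin p → ZMod (m' + 1) → ℝ => (PhiM h ψ)ᵀ * PhiM h ψ) := by
    simpa only [Matrix.mul_one] using gram_cont (P := Fin p) h 1
  have h1 : Integrable (fun φ => GG s (1 - (PhiM h φ)ᵀ * PhiM h φ))
      (gm (Fin p) (ZMod (m' + 1)) ((m' + 1 : ℕ) : NNReal)⁻¹) := by
    refine GG_integrable _ s _ (continuous_const.sub hcont) fun a b => ?_
    exact (integrable_const _).sub (hent1 a b)
  have hstep : ∫ φ, snormS s ((1 - (probeMatrix p n (m' + 1) φ)ᵀ *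
        probeMatrix p n (m' + 1) φ).map Complex.ofReal) ∂(gaussMeasure p (m' + 1)) ≤
      ∫ φ, 8 * GG s (1 - (PhiM h φ)ᵀ * PhiM h φ)
        ∂(gm (Fin p) (ZMod (m' + 1)) ((m' + 1 : ℕ) : NNReal)⁻¹) := by
    refine integral_mono_of_nonneg (μ := gaussMeasure p (m' + 1))
      (Filter.Eventually.of_forall fun _ => snormS_nonneg _ _) (h1.const_mul 8)
      (Filter.Eventually.of_forall fun φ => ?_)
    have e : (probeMatrix p n (m' + 1) φ)ᵀ * probeMatrix p n (m' + 1) φ =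
        (PhiM h φ)ᵀ * PhiM h φ := by
      rw [probe_eq]; rfl
    simp only [e]
    refine snormS_le s _ ?_
    simp [Matrix.transpose_sub, Matrix.transpose_mul]
  refine hstep.trans ?_
  rw [integral_const_mul]
  linarith
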